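/- Let W be a 2-dimensional complex vector space and let N ∈ 𝒦(ℂ). Then for every K ∈ 𝒦(W) the function w ↦ V(K,K,K, N·w) on W is the support function of a convex body Π_N K ∈ 𝒦(W*), and the map Π_N : 𝒦(W) → 𝒦(W*) is a continuous, translation invariant, SL(W,ℂ)-contravariant Minkowski valuation which is homogeneous of degree 3 (i.e., Π_N(λK) = λ³ Π_N K for λ > 0). -/

import Mathlib

open scoped Pointwise
open MeasureTheory Module

noncomputable section

section CommonDefs

variable {V V' A : Type*}
variable [NormedAddCommGroup V] [NormedSpace ℝ V]
variable [NormedAddCommGroup V'] [NormedSpace ℝ V']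
variable [NormedAddCommGroup A] [NormedSpace ℝ A]

/-- The supremum of a (pairing) functional over a convex body; used to express the
support function `h(K, ξ) = sup_{x ∈ K} ⟨ξ, x⟩` for the various pairings `p = ⟨ξ, ·⟩`. -/
def hSupp (K : ConvexBody V) (p : V → ℝ) : ℝ := sSup (p '' (K : Set V))

/-- The translate `x + K` of a convex body. -/
def ConvexBody.translate (K : ConvexBody V) (x : V) : ConvexBody V :=
  ⟨(fun y => x + y) '' (K : Set V), K.convex.translate x,
    K.isCompact.image (continuous_const.add continuous_id),
    K.nonempty.image _⟩

/-- The image of a convex body under a continuous linear map. -/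
def ConvexBody.mapCLM (f : V →L[ℝ] V') (K : ConvexBody V) : ConvexBody V' :=
  ⟨f '' (K : Set V), K.convex.linear_image (f : V →ₗ[ℝ] V'),
    K.isCompact.image f.continuous, K.nonempty.image _⟩

/-- The reflection `-K` of a convex body about the origin. -/
def ConvexBody.neg (K : ConvexBody V) : ConvexBody V :=
  K.mapCLM (-(ContinuousLinearMap.id ℝ V))

/-- The union of two convex bodies (a convex body provided it is convex). -/
def ConvexBody.union (K L : ConvexBody V) (h : Convex ℝ ((K : Set V) ∪ (L : Set V))) :
    ConvexBody V :=
  ⟨(K : Set V) ∪ (L : Set V), h, K.isCompact.union L.isCompact,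
    K.nonempty.mono Set.subset_union_left⟩

/-- The intersection of two convex bodies (a convex body provided it is nonempty). -/
def ConvexBody.inter (K L : ConvexBody V) (h : ((K : Set V) ∩ (L : Set V)).Nonempty) :
    ConvexBody V :=
  ⟨(K : Set V) ∩ (L : Set V), K.convex.inter L.convex,
    K.isCompact.inter_right L.isClosed, h⟩

/-- A Minkowski valuation: `Z(K ∪ L) + Z(K ∩ L) = Z(K) + Z(L)` (Minkowski addition)
whenever `K, L, K ∪ L` are convex bodies. -/
def IsMinkowskiValuation (Z : ConvexBody V → ConvexBody A) : Prop :=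
  ∀ (K L : ConvexBody V) (hU : Convex ℝ ((K : Set V) ∪ (L : Set V)))
    (hI : ((K : Set V) ∩ (L : Set V)).Nonempty),
    Z (K.union L hU) + Z (K.inter L hI) = Z K + Z L

/-- A real-valued valuation: `φ(K ∪ L) + φ(K ∩ L) = φ(K) + φ(L)`
whenever `K, L, K ∪ L` are convex bodies. -/
def IsValuation (φ : ConvexBody V → ℝ) : Prop :=
  ∀ (K L : ConvexBody V) (hU : Convex ℝ ((K : Set V) ∪ (L : Set V)))
    (hI : ((K : Set V) ∩ (L : Set V)).Nonempty),
    φ (K.union L hU) + φ (K.inter L hI) = φ K + φ L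

/-- Translation invariance of a map defined on convex bodies. -/
def IsTranslationInvariant {α : Type*} (Z : ConvexBody V → α) : Prop :=
  ∀ (K : ConvexBody V) (x : V), Z (K.translate x) = Z K

/-- The mixed volume (w.r.t. the Lebesgue (Haar) measure `μ`) of an `n`-tuple of convex
bodies, given by the polarization formula
`V(K₁, …, Kₙ) = (1/n!) ∑_{S ⊆ {1,…,n}} (-1)^{n - |S|} vol(∑_{i ∈ S} K_i)`. -/
def mixedVol [MeasurableSpace V] (μ : Measure V) {n : ℕ} (K : Fin n → ConvexBody V) : ℝ :=
  (n.factorial : ℝ)⁻¹ *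
    ∑ S : Finset (Fin n), (-1 : ℝ) ^ (n - S.card) * (μ (∑ i ∈ S, (K i : Set V))).toReal

/-- The extension `V(K, …, K, f)` (with `n - 1` copies of `K`) of the mixed volume to
continuous positively `1`-homogeneous functions `f` on the dual space, defined via
Aleksandrov's variational formula: `V(K,…,K,f)` is `1/n` times the right derivative at
`t = 0` of the volume of the Wulff shape (aka Aleksandrov body) of `h_K + t f`.
For `f = h_L` the Wulff shape is `K + t L`, so this indeed extends `L ↦ V(K, …, K, L)`. -/
def mixedVolFn [MeasurableSpace V] (μ : Measure V) (K : ConvexBody V)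
    (f : (V →L[ℝ] ℝ) → ℝ) : ℝ :=
  (Module.finrank ℝ V : ℝ)⁻¹ *
    derivWithin (fun t : ℝ =>
        (μ {x : V | ∀ ξ : V →L[ℝ] ℝ, ξ x ≤ hSupp K ξ + t * f ξ}).toReal)
      (Set.Ici 0) 0

/-- The dimension of a convex body: the dimension of (the direction of) its affine hull. -/
def bodyDim (K : ConvexBody V) : ℕ := Module.finrank ℝ (vectorSpan ℝ (K : Set V))

/-- A convex body contained in a subspace `E`, viewed as a convex body of `E`. -/
def bodyIn (E : Submodule ℝ V) (K : ConvexBody V) (h : (K : Set V) ⊆ (E : Set V)) :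
    ConvexBody ↥E :=
  ⟨Subtype.val ⁻¹' (K : Set V),
    K.convex.linear_preimage (E.subtype),
    by
      rw [Topology.IsEmbedding.subtypeVal.isCompact_iff,
        Set.image_preimage_eq_of_subset (by rw [Subtype.range_coe]; exact h)]
      exact K.isCompact,
    by obtain ⟨x, hx⟩ := K.nonempty; exact ⟨⟨x, h hx⟩, hx⟩⟩

/-- The properties of the components of McMullen's decomposition of (the support function
of) a Minkowski valuation: each `fᵢ(·, u)` is a continuous, translation invariant
valuation, homogeneous of degree `i`, and each `fᵢ(K, ·)` is continuous and positively
`1`-homogeneous. -/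
def McMullenProps (f : ℕ → ConvexBody V → V → ℝ) : Prop :=
  (∀ (i : ℕ) (u : V), Continuous fun K : ConvexBody V => f i K u) ∧
  (∀ (i : ℕ) (u : V), IsValuation fun K : ConvexBody V => f i K u) ∧
  (∀ (i : ℕ) (u : V), IsTranslationInvariant fun K : ConvexBody V => f i K u) ∧
  (∀ (i : ℕ) (K : ConvexBody V) (u : V) (t : ℝ), 0 < t → f i (t • K) u = t ^ i * f i K u) ∧
  (∀ (i : ℕ) (K : ConvexBody V), Continuous fun u : V => f i K u) ∧
  (∀ (i : ℕ) (K : ConvexBody V) (u : V) (t : ℝ), 0 < t → f i K (t • u) = t * f i K u)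

end CommonDefs

/-- The surface area measure `S(M, ·)` on `S¹ ⊆ ℂ` of a planar convex body `M`,
characterized (uniquely) by the property that it is a finite measure concentrated on the
unit circle with `∫_{S¹} h(L, α) dσ(α) = 2 V(M, L)` for every planar convex body `L`. -/
def IsSurfaceAreaMeasure (M : ConvexBody ℂ) (σ : Measure ℂ) : Prop :=
  IsFiniteMeasure σ ∧ σ (Metric.sphere (0 : ℂ) 1)ᶜ = 0 ∧
    ∀ L : ConvexBody ℂ,
      (∫ α, hSupp L (fun c => (c * (starRingEnd ℂ) α).re) ∂σ) = 2 * mixedVol volume ![M, L]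

section ComplexDefs

variable {W : Type*} [NormedAddCommGroup W] [NormedSpace ℂ W] [FiniteDimensional ℂ W]

/-- The determinant pairing `det(u, v)` on a 2-dimensional complex vector space,
with respect to a fixed basis `b`. -/
def cdet (b : Basis (Fin 2) ℂ W) (u v : W) : ℂ :=
  b.coord 0 u * b.coord 1 v - b.coord 1 u * b.coord 0 v

/-- `det(·, w) : W → ℂ` as a continuous real-linear map. -/
def cdetCLM (b : Basis (Fin 2) ℂ W) (w : W) : W →L[ℝ] ℂ :=
  LinearMap.toContinuousLinearMap
    (((b.coord 1 w) • (b.coord 0 : W →ₗ[ℂ] ℂ)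
      - (b.coord 0 w) • (b.coord 1 : W →ₗ[ℂ] ℂ)).restrictScalars ℝ)

/-- `det(K, w) = {det(k, w) : k ∈ K} ⊆ ℂ`. -/
def detBody (b : Basis (Fin 2) ℂ W) (K : ConvexBody W) (w : W) : ConvexBody ℂ :=
  K.mapCLM (cdetCLM b w)

/-- `N · w = {c • w : c ∈ N} ⊆ W` for a planar convex body `N ⊆ ℂ`. -/
def dotBody (N : ConvexBody ℂ) (w : W) : ConvexBody W :=
  N.mapCLM (LinearMap.toContinuousLinearMap ((LinearMap.toSpanSingleton ℂ W w).restrictScalars ℝ))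

/-- A complex-linear endomorphism, as a continuous real-linear map. -/
def cReal (g : W →ₗ[ℂ] W) : W →L[ℝ] W :=
  LinearMap.toContinuousLinearMap (g.restrictScalars ℝ)

/-- Precomposition `ξ ↦ ξ ∘ g` on the complex dual `W* = W →L[ℂ] ℂ`,
as a continuous real-linear map. The adjoint of `g` is `precompDual g`, and
`g^{-*} = precompDual g⁻¹`. -/
def precompDual (g : W →L[ℂ] W) : (W →L[ℂ] ℂ) →L[ℝ] (W →L[ℂ] ℂ) :=
  LinearMap.toContinuousLinearMap
    { toFun := fun ξ => ξ.comp g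
      map_add' := fun ξ η => ContinuousLinearMap.add_comp ξ η g
      map_smul' := fun r ξ => ContinuousLinearMap.smul_comp r ξ g }

/-- `Z : 𝒦(W) → 𝒦(W*)` is `SL(W,ℂ)`-contravariant: `Z(gK) = g^{-*} Z(K)` for every
`g ∈ SL(W,ℂ)`. -/
def IsSLContravariant (Z : ConvexBody W → ConvexBody (W →L[ℂ] ℂ)) : Prop :=
  ∀ g : W ≃L[ℂ] W, LinearMap.det ((g : W →L[ℂ] W) : W →ₗ[ℂ] W) = 1 →
    ∀ K : ConvexBody W,
      Z (K.mapCLM (cReal (g : W →ₗ[ℂ] W))) =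
        (Z K).mapCLM (precompDual (g.symm : W →L[ℂ] W))

/-- `Z : 𝒦(W) → 𝒦(W)` is `SL(W,ℂ)`-covariant: `Z(gK) = g Z(K)` for every
`g ∈ SL(W,ℂ)`. -/
def IsSLCovariant (Z : ConvexBody W → ConvexBody W) : Prop :=
  ∀ g : W ≃L[ℂ] W, LinearMap.det ((g : W →L[ℂ] W) : W →ₗ[ℂ] W) = 1 →
    ∀ K : ConvexBody W,
      Z (K.mapCLM (cReal (g : W →ₗ[ℂ] W))) = (Z K).mapCLM (cReal (g : W →ₗ[ℂ] W))

end ComplexDefs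

section MomentMaps

open scoped RealInnerProductSpace

variable {E : Type*} [NormedAddCommGroup E] [InnerProductSpace ℝ E]

/-- `φ` is a twice differentiable convex function whose gradient `G` has derivative `A` and takes
values in `C`, and whose growth at infinity is that of the support function of `C`. -/
structure IsMomentMap (φ : E → ℝ) (G : E → E) (A : E → E →L[ℝ] E) (C : Set E) : Prop where
  hasFDerivAt_potential : ∀ x, HasFDerivAt φ (innerSL ℝ (G x)) x
  hasFDerivAt : ∀ x, HasFDerivAt G (A x) x
  continuous_fderiv : Continuous A
  inner_nonneg : ∀ x v, 0 ≤ ⟪A x v, v⟫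
  mem : ∀ x, G x ∈ C
  bound : ∃ M : ℝ, ∀ x, ∀ c ∈ C, ⟪c, x⟫ - M ≤ φ x

namespace IsMomentMap

variable {φ ψ : E → ℝ} {G H : E → E} {A B : E → E →L[ℝ] E} {C D : Set E}

theorem add (h : IsMomentMap φ G A C) (k : IsMomentMap ψ H B D) :
    IsMomentMap (fun x => φ x + ψ x) (fun x => G x + H x) (fun x => A x + B x) (C + D) where
  hasFDerivAt_potential x := by
    rw [map_add]
    exact (h.hasFDerivAt_potential x).add (k.hasFDerivAt_potential x)
  hasFDerivAt x := (h.hasFDerivAt x).add (k.hasFDerivAt x)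
  continuous_fderiv := h.continuous_fderiv.add k.continuous_fderiv
  inner_nonneg x v := by
    rw [add_apply, inner_add_left]
    exact add_nonneg (h.inner_nonneg x v) (k.inner_nonneg x v)
  mem x := Set.add_mem_add (h.mem x) (k.mem x)
  bound := by
    obtain ⟨M, hM⟩ := h.bound
    obtain ⟨M', hM'⟩ := k.bound
    refine ⟨M + M', ?_⟩
    rintro x _ ⟨c, hc, d, hd, rfl⟩
    have h1 := hM x c hc
    have h2 := hM' x d hd
    simp only [inner_add_left]
    linarith

theorem smul (h : IsMomentMap φ G A C) {r : ℝ} (hr : 0 ≤ r) :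
    IsMomentMap (fun x => r * φ x) (fun x => r • G x) (fun x => r • A x) (r • C) where
  hasFDerivAt_potential x := by
    rw [map_smul]
    exact (h.hasFDerivAt_potential x).const_mul r
  hasFDerivAt x := (h.hasFDerivAt x).const_smul r
  continuous_fderiv := h.continuous_fderiv.const_smul r
  inner_nonneg x v := by
    rw [smul_apply, real_inner_smul_left]
    exact mul_nonneg hr (h.inner_nonneg x v)
  mem x := Set.smul_mem_smul_set (h.mem x)
  bound := by
    obtain ⟨M, hM⟩ := h.bound
    refine ⟨r * M, ?_⟩
    rintro x _ ⟨c, hc, rfl⟩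
    have h1 := mul_le_mul_of_nonneg_left (hM x c hc) hr
    simp only [real_inner_smul_left]
    linarith

theorem injective (h : IsMomentMap φ G A C) (hpos : ∀ x v, v ≠ 0 → 0 < ⟪A x v, v⟫) :
    Function.Injective G := by
  intro x y hxy
  by_contra hne
  have hv : y - x ≠ 0 := sub_ne_zero.mpr (Ne.symm hne)
  have hd : ∀ t : ℝ, HasDerivAt (fun t : ℝ => ⟪G (x + t • (y - x)), y - x⟫)
      ⟪A (x + t • (y - x)) (y - x), y - x⟫ t := by
    intro t
    have h1 : HasDerivAt (fun t : ℝ => x + t • (y - x)) (y - x) t := by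
      simpa using ((hasDerivAt_id t).smul_const (y - x)).const_add x
    have h2 := (h.hasFDerivAt (x + t • (y - x))).comp_hasDerivAt t h1
    simpa using h2.inner ℝ (hasDerivAt_const t (y - x))
  have hm : StrictMono (fun t : ℝ => ⟪G (x + t • (y - x)), y - x⟫) :=
    strictMono_of_deriv_pos fun t => by rw [(hd t).deriv]; exact hpos _ _ hv
  have := hm zero_lt_one
  simp [hxy] at this

theorem interior_subset_range [FiniteDimensional ℝ E] (h : IsMomentMap φ G A C) :
    interior C ⊆ Set.range G := by
  intro a ha
  obtain ⟨δ, hδ, hball⟩ := Metric.nhds_basis_closedBall.mem_iff.mp (mem_interior_iff_mem_nhds.mp ha)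
  obtain ⟨M, hM⟩ := h.bound
  have hφ : ∀ x, HasFDerivAt (fun x => φ x - ⟪a, x⟫) (innerSL ℝ (G x - a)) x := by
    intro x
    rw [map_sub]
    exact (h.hasFDerivAt_potential x).sub (innerSL ℝ a).hasFDerivAt
  have hgrow : ∀ x, δ * ‖x‖ - M ≤ φ x - ⟪a, x⟫ := by
    intro x
    rcases eq_or_ne x 0 with rfl | hx
    · simpa using hM 0 a (interior_subset ha)
    · have hx' : ‖x‖ ≠ 0 := norm_ne_zero_iff.mpr hx
      have hmem : a + (δ / ‖x‖) • x ∈ C := by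
        apply hball
        rw [Metric.mem_closedBall, dist_eq_norm, add_sub_cancel_left, norm_smul, norm_div,
          norm_norm, div_mul_cancel₀ _ hx', Real.norm_of_nonneg hδ.le]
      have h1 := hM x _ hmem
      rw [inner_add_left, real_inner_smul_left, real_inner_self_eq_norm_sq] at h1
      have h2 : δ / ‖x‖ * ‖x‖ ^ 2 = δ * ‖x‖ := by field_simp
      linarith
  have htend : Filter.Tendsto (fun x => φ x - ⟪a, x⟫) (Filter.cocompact E) Filter.atTop := by
    refine Filter.tendsto_atTop_mono hgrow ?_
    exact Filter.tendsto_atTop_add_const_right _ _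
      ((tendsto_norm_cocompact_atTop (E := E)).const_mul_atTop hδ)
  have hcont : Continuous fun x => φ x - ⟪a, x⟫ :=
    continuous_iff_continuousAt.mpr fun x => (hφ x).continuousAt
  obtain ⟨x, hx⟩ := hcont.exists_forall_le htend
  have hmin : IsLocalMin (fun x => φ x - ⟪a, x⟫) x := Filter.Eventually.of_forall hx
  have h0 := hmin.hasFDerivAt_eq_zero (hφ x)
  refine ⟨x, ?_⟩
  have h3 : ⟪G x - a, G x - a⟫ = 0 := congrArg (fun T => T (G x - a)) h0
  exact sub_eq_zero.mp (inner_self_eq_zero.mp h3)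

end IsMomentMap

theorem det_pos_of_inner_pos [FiniteDimensional ℝ E] (T : E →L[ℝ] E)
    (hT : ∀ v, v ≠ 0 → 0 < ⟪T v, v⟫) : 0 < T.det := by
  have hcont : Continuous fun t : ℝ =>
      ((1 - t) • ContinuousLinearMap.id ℝ E + t • T).det := by
    refine ContinuousLinearMap.continuous_det.comp ?_
    fun_prop
  have hne : ∀ t ∈ Set.Icc (0 : ℝ) 1,
      ((1 - t) • ContinuousLinearMap.id ℝ E + t • T).det ≠ 0 := by
    intro t ht h0
    have h1 := LinearMap.bot_lt_ker_of_det_eq_zero h0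
    obtain ⟨v, hv, hv0⟩ := (Submodule.ne_bot_iff _).mp h1.ne'
    have h2 : (1 - t) • v + t • T v = 0 := by simpa using hv
    have h3 : (1 - t) * ‖v‖ ^ 2 + t * ⟪T v, v⟫ = 0 := by
      have := congrArg (fun w => ⟪w, v⟫) h2
      simpa [inner_add_left, real_inner_smul_left, real_inner_self_eq_norm_sq] using this
    have h4 := hT v hv0
    have h5 : 0 < ‖v‖ ^ 2 := by positivity
    rcases eq_or_lt_of_le ht.1 with rfl | h
    · linarith
    · nlinarith [ht.2, mul_pos h h4, mul_nonneg (sub_nonneg.mpr ht.2) h5.le]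
  by_contra hle
  push Not at hle
  have := intermediate_value_Icc' (zero_le_one : (0 : ℝ) ≤ 1) hcont.continuousOn
  obtain ⟨t, ht, h0⟩ := this (show (0 : ℝ) ∈ Set.Icc _ _ from
    ⟨by simpa using hle, by simp [ContinuousLinearMap.det]⟩)
  exact hne t ht h0

namespace IsMomentMap

variable {φ : E → ℝ} {G : E → E} {A : E → E →L[ℝ] E} {C : Set E}
variable [FiniteDimensional ℝ E] [MeasurableSpace E] [BorelSpace E]

theorem integrable_det_and_measure_eq (h : IsMomentMap φ G A C)
    (hpos : ∀ x v, v ≠ 0 → 0 < ⟪A x v, v⟫) (hC : Convex ℝ C) (hC' : IsCompact C)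
    (μ : Measure E) [μ.IsAddHaarMeasure] :
    Integrable (fun x => (A x).det) μ ∧ (μ C).toReal = ∫ x, (A x).det ∂μ := by
  have hdet : ∀ x, 0 < (A x).det := fun x => det_pos_of_inner_pos _ (hpos x)
  have hcont : Continuous fun x => (A x).det :=
    ContinuousLinearMap.continuous_det.comp h.continuous_fderiv
  have hμ : μ (Set.range G) = μ C := by
    refine le_antisymm (measure_mono (Set.range_subset_iff.mpr h.mem)) ?_
    calc μ C ≤ μ (interior C ∪ frontier C) := by
          rw [← closure_eq_interior_union_frontier]; exact measure_mono subset_closure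
      _ ≤ μ (interior C) + μ (frontier C) := measure_union_le _ _
      _ = μ (interior C) := by rw [hC.addHaar_frontier μ, add_zero]
      _ ≤ _ := measure_mono h.interior_subset_range
  have hlin : ∫⁻ x, ENNReal.ofReal (A x).det ∂μ = μ C := by
    have := lintegral_abs_det_fderiv_eq_addHaar_image μ MeasurableSet.univ
      (fun x _ => (h.hasFDerivAt x).hasFDerivWithinAt) (h.injective hpos).injOn
    rw [Set.image_univ, hμ, Measure.restrict_univ] at this
    rw [← this]
    exact lintegral_congr fun x => by rw [abs_of_pos (hdet x)]
  have hnn : 0 ≤ᵐ[μ] fun x => (A x).det := Filter.Eventually.of_forall fun x => (hdet x).le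
  refine ⟨⟨hcont.aestronglyMeasurable, ?_⟩, ?_⟩
  · rw [hasFiniteIntegral_iff_ofReal hnn, hlin]
    exact hC'.measure_lt_top
  · rw [integral_eq_lintegral_of_nonneg_ae hnn hcont.aestronglyMeasurable, hlin]

end IsMomentMap

end MomentMaps

section MomentMapConstruction

open scoped RealInnerProductSpace

variable {E : Type*} [NormedAddCommGroup E] [InnerProductSpace ℝ E]

theorem exists_isMomentMap_closedBall : ∃ (φ : E → ℝ) (G : E → E) (A : E → E →L[ℝ] E),
    IsMomentMap φ G A (Metric.closedBall (0 : E) 1) ∧ ∀ x v, v ≠ 0 → 0 < ⟪A x v, v⟫ := by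
  have hpos : ∀ x : E, 0 < 1 + ‖x‖ ^ 2 := fun x => by positivity
  have hs : ∀ x : E, 0 < √(1 + ‖x‖ ^ 2) := fun x => Real.sqrt_pos.mpr (hpos x)
  have hφ : ∀ x : E, HasFDerivAt (fun x : E => √(1 + ‖x‖ ^ 2))
      (innerSL ℝ ((√(1 + ‖x‖ ^ 2))⁻¹ • x)) x := by
    intro x
    have h1 : HasFDerivAt (fun x : E => 1 + ‖x‖ ^ 2) (2 • innerSL ℝ x) x :=
      (hasStrictFDerivAt_norm_sq x).hasFDerivAt.const_add 1
    convert h1.sqrt (hpos x).ne' using 1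
    ext v
    have := (hs x).ne'
    simp
    field_simp
  have hG : ContDiff ℝ 1 (fun x : E => (√(1 + ‖x‖ ^ 2))⁻¹ • x) := by
    refine ContDiff.smul (ContDiff.inv ?_ fun x => (hs x).ne') contDiff_id
    exact ContDiff.sqrt (contDiff_const.add (contDiff_norm_sq ℝ)) fun x => (hpos x).ne'
  have hGd : ∀ x v : E, ⟪fderiv ℝ (fun x : E => (√(1 + ‖x‖ ^ 2))⁻¹ • x) x v, v⟫ =
      (√(1 + ‖x‖ ^ 2))⁻¹ * (‖v‖ ^ 2 - ⟪x, v⟫ ^ 2 / (1 + ‖x‖ ^ 2)) := by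
    intro x v
    have h2 : HasFDerivAt (fun x : E => (√(1 + ‖x‖ ^ 2))⁻¹)
        (-((√(1 + ‖x‖ ^ 2)) ^ 2)⁻¹ • innerSL ℝ ((√(1 + ‖x‖ ^ 2))⁻¹ • x)) x :=
      (hasDerivAt_inv (hs x).ne').comp_hasFDerivAt x (hφ x)
    have h3 := h2.smul (hasFDerivAt_id x)
    have h4 : fderiv ℝ (fun x : E => (√(1 + ‖x‖ ^ 2))⁻¹ • x) x = _ := h3.fderiv
    rw [h4]
    have := (hs x).ne'
    have := (hpos x).ne'
    simp [inner_add_left, real_inner_smul_left, Real.sq_sqrt (hpos x).le]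
    field_simp
    ring
  have hstrict : ∀ x v : E, v ≠ 0 →
      0 < ⟪fderiv ℝ (fun x : E => (√(1 + ‖x‖ ^ 2))⁻¹ • x) x v, v⟫ := by
    intro x v hv
    rw [hGd]
    refine mul_pos (inv_pos.mpr (hs x)) (sub_pos.mpr ?_)
    rw [div_lt_iff₀ (hpos x)]
    have h1 : ⟪x, v⟫ ^ 2 ≤ (‖x‖ * ‖v‖) ^ 2 := sq_le_sq' (neg_le_of_abs_le
      (abs_real_inner_le_norm x v)) (real_inner_le_norm x v)
    have h2 : 0 < ‖v‖ ^ 2 := by positivity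
    nlinarith
  have hle : ∀ x : E, ‖x‖ ≤ √(1 + ‖x‖ ^ 2) := fun x => Real.le_sqrt_of_sq_le (by linarith)
  refine ⟨_, _, _, ⟨hφ, fun x => (hG.differentiable one_ne_zero x).hasFDerivAt,
    hG.continuous_fderiv one_ne_zero, fun x v => ?_, fun x => ?_, 0, fun x c hc => ?_⟩, hstrict⟩
  · rcases eq_or_ne v 0 with rfl | hv
    · simp
    · exact (hstrict x v hv).le
  · rw [mem_closedBall_zero_iff, norm_smul, norm_inv, Real.norm_of_nonneg (hs x).le,
      inv_mul_le_one₀ (hs x)]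
    exact hle x
  · rw [mem_closedBall_zero_iff] at hc
    have h1 := real_inner_le_norm c x
    have h2 := mul_le_mul_of_nonneg_right hc (norm_nonneg x)
    linarith [hle x]

/-- A nonempty compact set is bounded by its support function. -/
theorem IsCompact.exists_sublinear_support {K : Set E} (hK : IsCompact K) (hne : K.Nonempty) :
    ∃ h : E → ℝ, Continuous h ∧ (∀ x, ∀ c ∈ K, ⟪c, x⟫ ≤ h x) ∧
      (∀ x, ∃ c ∈ K, h x = ⟪c, x⟫) := by
  have hex : ∀ x : E, ∃ c ∈ K, ∀ d ∈ K, ⟪d, x⟫ ≤ ⟪c, x⟫ := fun x =>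
    hK.exists_isMaxOn (f := fun c => ⟪c, x⟫) hne (by fun_prop)
  choose f hf hmax using hex
  refine ⟨fun x => ⟪f x, x⟫, ?_, fun x c hc => hmax x c hc, fun x => ⟨f x, hf x, rfl⟩⟩
  obtain ⟨R, hR⟩ := hK.isBounded.exists_norm_le
  have hR0 : 0 ≤ R := (norm_nonneg _).trans (hR _ (hf 0))
  refine (LipschitzWith.of_le_add_mul R.toNNReal fun x y => ?_).continuous
  have h1 := hmax y _ (hf x)
  have h2 : ⟪f x, x⟫ = ⟪f x, y⟫ + ⟪f x, x - y⟫ := by rw [inner_sub_right]; ring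
  have h3 := (real_inner_le_norm (f x) (x - y)).trans
    (mul_le_mul_of_nonneg_right (hR _ (hf x)) (norm_nonneg _))
  rw [Real.coe_toNNReal _ hR0, dist_eq_norm]
  linarith

theorem inner_fderiv_nonneg_of_convexOn {φ : E → ℝ} {G : E → E} (hc : ConvexOn ℝ Set.univ φ)
    (hφ : ∀ x, HasFDerivAt φ (innerSL ℝ (G x)) x) {T : E →L[ℝ] E} {x : E}
    (hG : HasFDerivAt G T x) (v : E) : 0 ≤ ⟪T v, v⟫ := by
  have hl : ∀ t : ℝ, HasDerivAt (fun t : ℝ => x + t • v) v t := fun t => by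
    simpa using ((hasDerivAt_id t).smul_const v).const_add x
  have hg : ∀ t : ℝ, HasDerivAt (fun t : ℝ => φ (x + t • v)) ⟪G (x + t • v), v⟫ t := fun t => by
    exact (hφ (x + t • v)).comp_hasDerivAt t (hl t)
  have hconv : ConvexOn ℝ Set.univ fun t : ℝ => φ (x + t • v) := by
    refine ⟨convex_univ, fun a _ b _ p q hp hq hpq => ?_⟩
    have := hc.2 (Set.mem_univ (x + a • v)) (Set.mem_univ (x + b • v)) hp hq hpq
    convert this using 2
    rw [smul_add, smul_add, add_add_add_comm, ← add_smul, hpq, one_smul, smul_smul, smul_smul,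
      ← add_smul, smul_eq_mul, smul_eq_mul]
  have hmono : Monotone fun t : ℝ => ⟪G (x + t • v), v⟫ := by
    have h1 := hconv.monotoneOn_deriv fun t _ => (hg t).differentiableAt
    intro a b hab
    simpa [(hg _).deriv] using h1 (Set.mem_univ a) (Set.mem_univ b) hab
  have hd : HasDerivAt (fun t : ℝ => ⟪G (x + t • v), v⟫) ⟪T v, v⟫ 0 := by
    have hG' : HasFDerivAt G T (x + (0 : ℝ) • v) := by simpa using hG
    simpa using (hG'.comp_hasDerivAt 0 (hl 0)).inner ℝ (hasDerivAt_const 0 v)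
  rw [← hd.deriv]
  exact hmono.deriv_nonneg

open scoped Convolution in
theorem exists_isMomentMap [FiniteDimensional ℝ E] {K : Set E} (hK : IsCompact K)
    (hconv : Convex ℝ K) (hne : K.Nonempty) :
    ∃ (φ : E → ℝ) (G : E → E) (A : E → E →L[ℝ] E), IsMomentMap φ G A K := by
  borelize E
  obtain ⟨h, hcont, hge, hatt⟩ := hK.exists_sublinear_support hne
  have hadd : ∀ x y, h (x + y) ≤ h x + h y := by
    intro x y
    obtain ⟨c, hc, hcx⟩ := hatt (x + y)
    rw [hcx, inner_add_right]
    exact add_le_add (hge x c hc) (hge y c hc)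
  have hsmul : ∀ (r : ℝ) x, 0 ≤ r → h (r • x) ≤ r * h x := by
    intro r x hr
    obtain ⟨c, hc, hcx⟩ := hatt (r • x)
    rw [hcx, real_inner_smul_right]
    exact mul_le_mul_of_nonneg_left (hge x c hc) hr
  let ρ : ContDiffBump (0 : E) := ⟨1, 2, one_pos, one_lt_two⟩
  let μ : Measure E := Measure.addHaar
  let w : E → ℝ := ρ.normed μ
  have hw0 : ∀ x, 0 ≤ w x := ρ.nonneg_normed
  have hw1 : ∫ x, w x ∂μ = 1 := ρ.integral_normed
  have hwc : Continuous w := ρ.continuous_normed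
  have hws : HasCompactSupport w := ρ.hasCompactSupport_normed
  let φ : E → ℝ := w ⋆[ContinuousLinearMap.lsmul ℝ ℝ, μ] h
  have hφ : ∀ x, φ x = ∫ y, w y * h (x - y) ∂μ := fun x => rfl
  have hsmooth : ContDiff ℝ 2 φ :=
    hws.contDiff_convolution_left _ ρ.contDiff_normed hcont.locallyIntegrable
  have hint : ∀ f : E → ℝ, Continuous f → Integrable (fun y => w y * f y) μ := fun f hf =>
    (hwc.mul hf).integrable_of_hasCompactSupport hws.mul_right
  have hsub : ∀ x u, φ (x + u) ≤ φ x + h u := by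
    intro x u
    have h1 : φ x + h u = ∫ y, w y * (h (x - y) + h u) ∂μ := by
      simp_rw [mul_add]
      rw [integral_add (hint _ (by fun_prop)) (hint _ (by fun_prop)), integral_mul_const, hw1,
        one_mul, hφ]
    rw [h1, hφ]
    refine integral_mono (hint _ (by fun_prop)) (hint _ (by fun_prop)) fun y => ?_
    refine mul_le_mul_of_nonneg_left ?_ (hw0 y)
    rw [add_sub_right_comm]
    exact hadd _ _
  have hφconv : ConvexOn ℝ Set.univ φ := by
    refine ⟨convex_univ, fun x _ y _ a b ha hb hab => ?_⟩
    have h1 : a • φ x + b • φ y = ∫ z, w z * (a * h (x - z) + b * h (y - z)) ∂μ := by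
      simp_rw [mul_add]
      rw [integral_add (hint _ (by fun_prop)) (hint _ (by fun_prop)), smul_eq_mul, smul_eq_mul,
        hφ, hφ, ← integral_const_mul, ← integral_const_mul]
      congr 1 <;> exact integral_congr_ae (Filter.Eventually.of_forall fun z => by ring)
    rw [h1, hφ]
    refine integral_mono (hint _ (by fun_prop)) (hint _ (by fun_prop)) fun z => ?_
    refine mul_le_mul_of_nonneg_left ?_ (hw0 z)
    have h2 : a • x + b • y - z = a • (x - z) + b • (y - z) := by
      rw [smul_sub, smul_sub, sub_add_sub_comm, ← add_smul, hab, one_smul]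
    rw [h2]
    exact (hadd _ _).trans (add_le_add (hsmul a _ ha) (hsmul b _ hb))
  have hbound : ∀ x, h x - ∫ y, w y * h y ∂μ ≤ φ x := by
    intro x
    rw [sub_le_iff_le_add, hφ, ← integral_add (hint _ (by fun_prop)) (hint _ hcont)]
    calc h x = ∫ y, w y * h x ∂μ := by rw [integral_mul_const, hw1, one_mul]
      _ ≤ _ := by
        refine integral_mono (hint _ continuous_const)
          ((hint _ (by fun_prop)).add (hint _ hcont)) fun y => ?_
        change w y * h x ≤ w y * h (x - y) + w y * h y
        rw [← mul_add]
        refine mul_le_mul_of_nonneg_left ?_ (hw0 y)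
        simpa using hadd (x - y) y
  let G : E → E := fun x => (InnerProductSpace.toDual ℝ E).symm (fderiv ℝ φ x)
  have hGφ : ∀ x, HasFDerivAt φ (innerSL ℝ (G x)) x := by
    intro x
    have h1 : innerSL ℝ (G x) = fderiv ℝ φ x :=
      (InnerProductSpace.toDual ℝ E).apply_symm_apply _
    rw [h1]
    exact (hsmooth.differentiable two_ne_zero x).hasFDerivAt
  have hGs : ContDiff ℝ 1 G := by
    refine (InnerProductSpace.toDual ℝ E).symm.contDiff.comp (hsmooth.fderiv_right ?_)
    norm_num
  have hGd : ∀ x, HasFDerivAt G (fderiv ℝ G x) x := fun x =>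
    (hGs.differentiable one_ne_zero x).hasFDerivAt
  have hGle : ∀ x u, ⟪G x, u⟫ ≤ h u := by
    intro x u
    have h1 : HasDerivAt (fun t : ℝ => φ (x + t • u)) ⟪G x, u⟫ 0 := by
      have hl : HasDerivAt (fun t : ℝ => x + t • u) u 0 := by
        simpa using ((hasDerivAt_id (0 : ℝ)).smul_const u).const_add x
      have hG' : HasFDerivAt φ (innerSL ℝ (G x)) (x + (0 : ℝ) • u) := by simpa using hGφ x
      exact hG'.comp_hasDerivAt 0 hl
    have h2 := (hasDerivAt_iff_tendsto_slope.mp h1).mono_left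
      (nhdsWithin_mono 0 (fun t (ht : 0 < t) => ht.ne') : nhdsWithin (0 : ℝ) (Set.Ioi 0) ≤ _)
    refine le_of_tendsto h2 (eventually_nhdsWithin_of_forall fun t (ht : 0 < t) => ?_)
    have h3 := (hsub x (t • u)).trans (add_le_add_right (hsmul t u ht.le) _)
    rw [slope_def_field]
    simp only [sub_zero, zero_smul, add_zero]
    rw [div_le_iff₀ ht]
    linarith
  refine ⟨φ, G, fderiv ℝ G, hGφ, hGd, hGs.continuous_fderiv one_ne_zero,
    fun x v => inner_fderiv_nonneg_of_convexOn hφconv hGφ (hGd x) v, fun x => ?_,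
    ∫ y, w y * h y ∂μ, fun x c hc => ?_⟩
  · by_contra hx
    obtain ⟨f, u, h1, h2⟩ := geometric_hahn_banach_closed_point hconv hK.isClosed hx
    obtain ⟨c, hc, hcx⟩ := hatt ((InnerProductSpace.toDual ℝ E).symm f)
    have h3 := hGle x ((InnerProductSpace.toDual ℝ E).symm f)
    rw [hcx, real_inner_comm, real_inner_comm _ c, InnerProductSpace.toDual_symm_apply,
      InnerProductSpace.toDual_symm_apply] at h3
    linarith [h1 c hc]
  · linarith [hge x c hc, hbound x]

end MomentMapConstruction

section Transfer

open scoped RealInnerProductSpace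

section Inner

variable {E : Type*} [NormedAddCommGroup E] [InnerProductSpace ℝ E] [FiniteDimensional ℝ E]
  [MeasurableSpace E] [BorelSpace E]

theorem exists_forall_measure_eq_integral_det [Nontrivial E] {K L M : Set E} (hK : IsCompact K)
    (hL : IsCompact L) (hM : IsCompact M) (hK' : Convex ℝ K) (hL' : Convex ℝ L) (hM' : Convex ℝ M)
    (hKn : K.Nonempty) (hLn : L.Nonempty) (hMn : M.Nonempty) (μ : Measure E) [μ.IsAddHaarMeasure]
    {r : ℝ} (hr : 0 < r) :
    ∃ X Y Z : E → E →L[ℝ] E, ∀ s t u : ℝ, 0 ≤ s → 0 ≤ t → 0 ≤ u →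
      Integrable (fun x => (s • X x + t • Y x + u • Z x).det) μ ∧
      (μ (s • (K + r • Metric.closedBall (0 : E) 1) + t • (L + r • Metric.closedBall (0 : E) 1) +
        u • (M + r • Metric.closedBall (0 : E) 1))).toReal =
          ∫ x, (s • X x + t • Y x + u • Z x).det ∂μ := by
  obtain ⟨φB, GB, B, hB, hBpos⟩ := exists_isMomentMap_closedBall (E := E)
  have hreg : ∀ C : Set E, IsCompact C → Convex ℝ C → C.Nonempty →
      ∃ (φ : E → ℝ) (G : E → E) (A : E → E →L[ℝ] E),
        IsMomentMap φ G A (C + r • Metric.closedBall (0 : E) 1) ∧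
          ∀ x v, v ≠ 0 → 0 < ⟪A x v, v⟫ := by
    intro C hC hC' hCn
    obtain ⟨φ, G, A, hA⟩ := exists_isMomentMap hC hC' hCn
    refine ⟨_, _, _, hA.add (hB.smul hr.le), fun x v hv => ?_⟩
    rw [add_apply, smul_apply, inner_add_left, real_inner_smul_left]
    exact add_pos_of_nonneg_of_pos (hA.inner_nonneg x v) (mul_pos hr (hBpos x v hv))
  obtain ⟨_, _, X, hX, hXpos⟩ := hreg K hK hK' hKn
  obtain ⟨_, _, Y, hY, hYpos⟩ := hreg L hL hL' hLn
  obtain ⟨_, _, Z, hZ, hZpos⟩ := hreg M hM hM' hMn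
  have hball : IsCompact (r • Metric.closedBall (0 : E) 1) :=
    (isCompact_closedBall (0 : E) 1).smul r
  have hball' : Convex ℝ (r • Metric.closedBall (0 : E) 1) := (convex_closedBall 0 1).smul r
  have hballn : (r • Metric.closedBall (0 : E) 1).Nonempty :=
    (Metric.nonempty_closedBall.mpr zero_le_one).smul_set
  refine ⟨X, Y, Z, fun s t u hs ht hu => ?_⟩
  by_cases h0 : s = 0 ∧ t = 0 ∧ u = 0
  · obtain ⟨rfl, rfl, rfl⟩ := h0
    have hd : ((0 : ℝ) • (0 : E →L[ℝ] E)).det = 0 := by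
      simp [ContinuousLinearMap.det]
    rw [Set.zero_smul_set (hKn.add hballn), Set.zero_smul_set (hLn.add hballn),
      Set.zero_smul_set (hMn.add hballn)]
    simp only [smul_zero] at hd
    simp [hd, ← Set.singleton_zero]
  · refine (((hX.smul hs).add (hY.smul ht)).add (hZ.smul hu)).integrable_det_and_measure_eq ?_
      ((((hK'.add hball').smul s).add ((hL'.add hball').smul t)).add ((hM'.add hball').smul u))
      ((((hK.add hball).smul s).add ((hL.add hball).smul t)).add ((hM.add hball).smul u)) μ
    intro x v hv
    simp only [add_apply, smul_apply, inner_add_left, real_inner_smul_left]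
    have h1 := hXpos x v hv
    have h2 := hYpos x v hv
    have h3 := hZpos x v hv
    rcases hs.lt_or_eq with h | h
    · positivity
    · rcases ht.lt_or_eq with h' | h'
      · positivity
      · have : 0 < u := hu.lt_of_ne fun h'' => h0 ⟨h.symm, h'.symm, h''.symm⟩
        positivity

theorem tendsto_measure_add_smul_closedBall {K L M : Set E} (hK : IsCompact K)
    (hL : IsCompact L) (hM : IsCompact M) (μ : Measure E) [μ.IsAddHaarMeasure] {s t u : ℝ}
    (hs : 0 ≤ s) (ht : 0 ≤ t) (hu : 0 ≤ u) :
    Filter.Tendsto (fun r : ℝ =>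
      (μ (s • (K + r • Metric.closedBall (0 : E) 1) + t • (L + r • Metric.closedBall (0 : E) 1) +
        u • (M + r • Metric.closedBall (0 : E) 1))).toReal) (nhdsWithin 0 (Set.Ioi 0))
      (nhds (μ (s • K + t • L + u • M)).toReal) := by
  have hC : IsCompact (s • K + t • L + u • M) := ((hK.smul s).add (hL.smul t)).add (hM.smul u)
  refine (ENNReal.tendsto_toReal hC.measure_lt_top.ne).comp ?_
  have hlim : Filter.Tendsto (fun r : ℝ => μ (Metric.cthickening ((s + t + u) * r)
      (s • K + t • L + u • M))) (nhdsWithin 0 (Set.Ioi 0)) (nhds (μ (s • K + t • L + u • M))) := by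
    refine (tendsto_measure_cthickening_of_isCompact hC).comp ?_
    have : Filter.Tendsto (fun r : ℝ => (s + t + u) * r) (nhds 0) (nhds ((s + t + u) * 0)) :=
      tendsto_const_nhds.mul Filter.tendsto_id
    rw [mul_zero] at this
    exact this.mono_left nhdsWithin_le_nhds
  refine tendsto_of_tendsto_of_tendsto_of_le_of_le' tendsto_const_nhds hlim
    (Filter.Eventually.of_forall fun r => measure_mono ?_)
    (eventually_nhdsWithin_of_forall fun r (hr : 0 < r) => measure_mono ?_)
  · have h0 : ∀ C : Set E, C ⊆ C + r • Metric.closedBall (0 : E) 1 := fun C =>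
      Set.subset_add_left C ⟨0, by simp, smul_zero r⟩
    exact Set.add_subset_add (Set.add_subset_add (Set.smul_set_mono (h0 K))
      (Set.smul_set_mono (h0 L))) (Set.smul_set_mono (h0 M))
  · rintro _ ⟨_, ⟨_, ⟨_, ⟨k, hk, _, ⟨a, ha, rfl⟩, rfl⟩, rfl⟩, _,
      ⟨_, ⟨l, hl, _, ⟨b, hb, rfl⟩, rfl⟩, rfl⟩, rfl⟩, _,
      ⟨_, ⟨m, hm, _, ⟨c, hc, rfl⟩, rfl⟩, rfl⟩, rfl⟩
    refine Metric.mem_cthickening_of_dist_le _ (s • k + t • l + u • m) _ _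
      (Set.add_mem_add (Set.add_mem_add (Set.smul_mem_smul_set hk) (Set.smul_mem_smul_set hl))
        (Set.smul_mem_smul_set hm)) ?_
    rw [mem_closedBall_zero_iff] at ha hb hc
    have h1 : s • (k + r • a) + t • (l + r • b) + u • (m + r • c) - (s • k + t • l + u • m) =
        (s * r) • a + (t * r) • b + (u * r) • c := by
      simp only [smul_add, smul_smul]; abel
    have h2 : ∀ (p : ℝ) (z : E), 0 ≤ p → ‖z‖ ≤ 1 → ‖(p * r) • z‖ ≤ p * r := by
      intro p z hp hz
      rw [norm_smul, Real.norm_of_nonneg (mul_nonneg hp hr.le)]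
      exact mul_le_of_le_one_right (mul_nonneg hp hr.le) hz
    change dist (s • (k + r • a) + t • (l + r • b) + u • (m + r • c)) _ ≤ _
    rw [dist_eq_norm, h1]
    refine norm_add₃_le.trans ?_
    linarith [h2 s a hs ha, h2 t b ht hb, h2 u c hu hc]

/-- Linear relations between determinants of nonnegative combinations of endomorphisms
carry over to volumes of Minkowski combinations of convex bodies. -/
theorem sum_measure_eq_zero_of_sum_det_eq_zero [Nontrivial E] {K L M : Set E} (hK : IsCompact K)
    (hL : IsCompact L) (hM : IsCompact M) (hK' : Convex ℝ K) (hL' : Convex ℝ L) (hM' : Convex ℝ M)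
    (hKn : K.Nonempty) (hLn : L.Nonempty) (hMn : M.Nonempty) (μ : Measure E) [μ.IsAddHaarMeasure]
    {κ : Type*} (I : Finset κ) (α s t u : κ → ℝ) (hs : ∀ i ∈ I, 0 ≤ s i) (ht : ∀ i ∈ I, 0 ≤ t i)
    (hu : ∀ i ∈ I, 0 ≤ u i)
    (hdet : ∀ X Y Z : E →L[ℝ] E, ∑ i ∈ I, α i * (s i • X + t i • Y + u i • Z).det = 0) :
    ∑ i ∈ I, α i * (μ (s i • K + t i • L + u i • M)).toReal = 0 := by
  refine tendsto_nhds_unique (f := fun r : ℝ => ∑ i ∈ I, α i *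
    (μ (s i • (K + r • Metric.closedBall (0 : E) 1) + t i • (L + r • Metric.closedBall (0 : E) 1) +
        u i • (M + r • Metric.closedBall (0 : E) 1))).toReal) (l := nhdsWithin 0 (Set.Ioi 0))
    (tendsto_finsetSum _ fun i hi => (tendsto_measure_add_smul_closedBall hK hL hM μ
      (hs i hi) (ht i hi) (hu i hi)).const_mul _) ?_
  refine tendsto_const_nhds.congr' (eventually_nhdsWithin_of_forall fun r (hr : 0 < r) => ?_)
  obtain ⟨X, Y, Z, h⟩ := exists_forall_measure_eq_integral_det hK hL hM hK' hL' hM' hKn hLn hMn μ hr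
  calc (0 : ℝ) = ∫ x, ∑ i ∈ I, α i * (s i • X x + t i • Y x + u i • Z x).det ∂μ := by
        simp [hdet]
    _ = ∑ i ∈ I, α i * ∫ x, (s i • X x + t i • Y x + u i • Z x).det ∂μ := by
        rw [integral_finsetSum _ fun i hi =>
          (h _ _ _ (hs i hi) (ht i hi) (hu i hi)).1.const_mul _]
        exact Finset.sum_congr rfl fun i _ => integral_const_mul _ _
    _ = _ := Finset.sum_congr rfl fun i hi => by rw [(h _ _ _ (hs i hi) (ht i hi) (hu i hi)).2]

end Inner

theorem sum_measure_eq_zero_of_sum_matrix_det_eq_zero {V : Type*} [NormedAddCommGroup V]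
    [NormedSpace ℝ V] {n : ℕ} [NeZero n] (hn : finrank ℝ V = n) [MeasurableSpace V] [BorelSpace V]
    {K L M : Set V} (hK : IsCompact K)
    (hL : IsCompact L) (hM : IsCompact M) (hK' : Convex ℝ K) (hL' : Convex ℝ L) (hM' : Convex ℝ M)
    (hKn : K.Nonempty) (hLn : L.Nonempty) (hMn : M.Nonempty) (μ : Measure V) [μ.IsAddHaarMeasure]
    {κ : Type*} (I : Finset κ) (α s t u : κ → ℝ) (hs : ∀ i ∈ I, 0 ≤ s i) (ht : ∀ i ∈ I, 0 ≤ t i)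
    (hu : ∀ i ∈ I, 0 ≤ u i)
    (hdet : ∀ X Y Z : Matrix (Fin n) (Fin n) ℝ,
      ∑ i ∈ I, α i * (s i • X + t i • Y + u i • Z).det = 0) :
    ∑ i ∈ I, α i * (μ (s i • K + t i • L + u i • M)).toReal = 0 := by
  have : FiniteDimensional ℝ V :=
    FiniteDimensional.of_finrank_pos (hn ▸ Nat.pos_of_ne_zero (NeZero.ne n))
  have hfr : finrank ℝ V = finrank ℝ (EuclideanSpace ℝ (Fin n)) := by simp [hn]
  let e : V ≃L[ℝ] EuclideanSpace ℝ (Fin n) := ContinuousLinearEquiv.ofFinrankEq hfr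
  have : Nontrivial (EuclideanSpace ℝ (Fin n)) :=
    nontrivial_of_finrank_pos (R := ℝ) (by simpa using Nat.pos_of_ne_zero (NeZero.ne n))
  have := e.isAddHaarMeasure_map μ
  have key := sum_measure_eq_zero_of_sum_det_eq_zero (hK.image e.continuous)
    (hL.image e.continuous) (hM.image e.continuous) (hK'.linear_image e.toLinearEquiv.toLinearMap)
    (hL'.linear_image e.toLinearEquiv.toLinearMap) (hM'.linear_image e.toLinearEquiv.toLinearMap) (hKn.image e)
    (hLn.image e) (hMn.image e) (μ.map e) I α s t u hs ht hu fun X Y Z => by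
      let b := (EuclideanSpace.basisFun (Fin n) ℝ).toBasis
      have hd : ∀ T : EuclideanSpace ℝ (Fin n) →L[ℝ] EuclideanSpace ℝ (Fin n),
          T.det = (LinearMap.toMatrix b b (T : _ →ₗ[ℝ] _)).det := fun T =>
        (LinearMap.det_toMatrix b _).symm
      simp_rw [hd, ContinuousLinearMap.toLinearMap_add, ContinuousLinearMap.toLinearMap_smul,
        map_add, map_smul]
      exact hdet _ _ _
  have himg : ∀ C : Set V, (μ.map e) (e '' C) = μ C := fun C => by
    refine (e.toHomeomorph.toMeasurableEquiv.map_apply (μ := μ) (e '' C)).trans ?_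
    exact congrArg μ (e.injective.preimage_image C)
  rw [← key]
  refine Finset.sum_congr rfl fun i _ => ?_
  rw [← himg, Set.image_add, Set.image_add]
  simp_rw [image_smul_set]

end Transfer

section MixedVolumeExpansion

theorem Matrix.exists_det_smul_add_smul_eq (A B : Matrix (Fin 4) (Fin 4) ℝ) :
    ∃ c₀ c₁ c₂ c₃ : ℝ, ∀ s t : ℝ, (s • A + t • B).det =
      A.det * s ^ 4 + c₃ * s ^ 3 * t + c₂ * s ^ 2 * t ^ 2 + c₁ * s * t ^ 3 + c₀ * t ^ 4 := by
  set p : Polynomial ℝ :=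
    ((Polynomial.X : Polynomial ℝ) • A.map Polynomial.C + B.map Polynomial.C).det with hp
  have hdeg : p.natDegree < 5 := Nat.lt_succ_of_le (by
    simpa using Polynomial.natDegree_det_X_add_C_le A B)
  have hlead : p.coeff 4 = A.det := by simpa using Polynomial.coeff_det_X_add_C_card A B
  have heval : ∀ s : ℝ, p.eval s = (s • A + B).det := by
    intro s
    rw [hp, ← Polynomial.coe_evalRingHom, RingHom.map_det]
    congr 1
    ext i j
    simp
    exact mul_comm _ _
  refine ⟨p.coeff 0, p.coeff 1, p.coeff 2, p.coeff 3, fun s t => ?_⟩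
  rcases eq_or_ne t 0 with rfl | ht
  · simp [mul_comm]
  · have h1 : s • A + t • B = t • ((s / t) • A + B) := by
      rw [smul_add, smul_smul, mul_div_cancel₀ _ ht]
    rw [h1, Matrix.det_smul, ← heval, Polynomial.eval_eq_sum_range' hdeg]
    simp only [Finset.sum_range_succ, Finset.sum_range_zero, hlead, Fintype.card_fin]
    field_simp
    ring

/-- Third finite difference of `s ↦ det (s • A + B)`, corrected by its leading term. -/
def Matrix.thirdDiffDet (A B : Matrix (Fin 4) (Fin 4) ℝ) : ℝ :=
  ((3 : ℝ) • A + B).det - 3 * ((2 : ℝ) • A + B).det + 3 * (A + B).det - B.det - 36 * A.det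

attribute [local instance] Matrix.normedAddCommGroup Matrix.normedSpace

theorem Matrix.differentiable_det :
    Differentiable ℝ fun A : Matrix (Fin 4) (Fin 4) ℝ => A.det := by
  simp_rw [Matrix.det_apply']
  fun_prop

theorem Matrix.thirdDiffDet_eq_fderiv (A B : Matrix (Fin 4) (Fin 4) ℝ) :
    thirdDiffDet A B = 6 * fderiv ℝ (fun A : Matrix (Fin 4) (Fin 4) ℝ => A.det) A B := by
  obtain ⟨c₀, c₁, c₂, c₃, h⟩ := Matrix.exists_det_smul_add_smul_eq A B
  have h1 : HasDerivAt (fun t : ℝ => (A + t • B).det)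
      (fderiv ℝ (fun A : Matrix (Fin 4) (Fin 4) ℝ => A.det) A B) 0 := by
    have hl : HasDerivAt (fun t : ℝ => A + t • B) B 0 := by
      have := ((hasDerivAt_id (0 : ℝ)).smul_const B).const_add A
      rw [one_smul] at this
      exact this
    have hd : HasFDerivAt (fun A : Matrix (Fin 4) (Fin 4) ℝ => A.det)
      (fderiv ℝ (fun A : Matrix (Fin 4) (Fin 4) ℝ => A.det) A) (A + (0 : ℝ) • B) := by
      simpa using (Matrix.differentiable_det A).hasFDerivAt
    exact hd.comp_hasDerivAt 0 hl
  have h2 : HasDerivAt (fun t : ℝ => (A + t • B).det) c₃ 0 := by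
    have h3 : (fun t : ℝ => (A + t • B).det) =
        fun t => A.det + c₃ * t + c₂ * t ^ 2 + c₁ * t ^ 3 + c₀ * t ^ 4 := by
      ext t
      simpa using h 1 t
    rw [h3]
    have h4 := ((((hasDerivAt_id (0 : ℝ)).const_mul c₃).const_add A.det).add
      (((hasDerivAt_id (0 : ℝ)).pow 2).const_mul c₂)).add
      (((hasDerivAt_id (0 : ℝ)).pow 3).const_mul c₁) |>.add
      (((hasDerivAt_id (0 : ℝ)).pow 4).const_mul c₀)
    exact h4.congr_deriv (by simp)
  rw [h1.unique h2, thirdDiffDet]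
  have e3 := h 3 1
  have e2 := h 2 1
  have e1 := h 1 1
  have e0 := h 0 1
  simp only [one_smul, zero_smul, zero_add] at e0 e1 e2 e3
  rw [e3, e2, e1, e0]
  ring

theorem Matrix.thirdDiffDet_add_smul (A B C : Matrix (Fin 4) (Fin 4) ℝ) (b c : ℝ) :
    thirdDiffDet A (b • B + c • C) = b * thirdDiffDet A B + c * thirdDiffDet A C := by
  simp only [thirdDiffDet_eq_fderiv, map_add, map_smul, smul_eq_mul]
  ring

/-- The mixed volume `V(K, K, K, L)` in dimension four, written with sets. -/
def mixedVolThree {V : Type*} [NormedAddCommGroup V] [NormedSpace ℝ V] [MeasurableSpace V]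
    (μ : Measure V) (K L : Set V) : ℝ :=
  (μ.real ((3 : ℝ) • K + L) - 3 * μ.real ((2 : ℝ) • K + L) + 3 * μ.real (K + L) - μ.real L
    - 36 * μ.real K) / 24

variable {V : Type*} [NormedAddCommGroup V] [NormedSpace ℝ V] [MeasurableSpace V] [BorelSpace V]
  {K L M : Set V}

theorem mixedVolThree_add_smul (hV : finrank ℝ V = 4) (hK : IsCompact K)
    (hL : IsCompact L) (hM : IsCompact M) (hK' : Convex ℝ K) (hL' : Convex ℝ L) (hM' : Convex ℝ M)
    (hKn : K.Nonempty) (hLn : L.Nonempty) (hMn : M.Nonempty) (μ : Measure V) [μ.IsAddHaarMeasure]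
    {b c : ℝ} (hb : 0 ≤ b) (hc : 0 ≤ c) :
    mixedVolThree μ K (b • L + c • M) = b * mixedVolThree μ K L + c * mixedVolThree μ K M := by
  have key := sum_measure_eq_zero_of_sum_matrix_det_eq_zero hV hK hL hM hK' hL' hM' hKn hLn hMn μ
    Finset.univ
    ![1, -3, 3, -1, -36 + 36 * b + 36 * c, -b, 3 * b, -3 * b, b, -c, 3 * c, -3 * c, c]
    ![3, 2, 1, 0, 1, 3, 2, 1, 0, 3, 2, 1, 0] ![b, b, b, b, 0, 1, 1, 1, 1, 0, 0, 0, 0]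
    ![c, c, c, c, 0, 0, 0, 0, 0, 1, 1, 1, 1]
    (by simp [Fin.forall_fin_succ]) (by simp [Fin.forall_fin_succ, hb])
    (by simp [Fin.forall_fin_succ, hc]) (fun X Y Z => by
      have := Matrix.thirdDiffDet_add_smul X Y Z b c
      simp only [Matrix.thirdDiffDet, ← add_assoc] at this
      simp [Fin.sum_univ_succ]
      linarith)
  simp [Fin.sum_univ_succ, Set.zero_smul_set, hKn, hLn, hMn] at key
  simp only [mixedVolThree, Measure.real, ← add_assoc]
  linarith

/-- The coefficients of `t ^ 2`, `t ^ 3` in the volume of `K + t • L`. -/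
theorem measure_add_smul_eq (hV : finrank ℝ V = 4) (hK : IsCompact K)
    (hL : IsCompact L) (hK' : Convex ℝ K) (hL' : Convex ℝ L)
    (hKn : K.Nonempty) (hLn : L.Nonempty) (μ : Measure V) [μ.IsAddHaarMeasure]
    {t : ℝ} (ht : 0 ≤ t) :
    μ.real (K + t • L) = μ.real K + t * (4 * mixedVolThree μ K L) +
      t ^ 2 * ((-μ.real ((3 : ℝ) • K + L) + 4 * μ.real ((2 : ℝ) • K + L) - 5 * μ.real (K + L) +
        2 * μ.real L + 22 * μ.real K) / 2) +
      t ^ 3 * ((2 * μ.real ((3 : ℝ) • K + L) - 9 * μ.real ((2 : ℝ) • K + L) +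
        18 * μ.real (K + L) - 11 * μ.real L - 36 * μ.real K) / 6) +
      t ^ 4 * μ.real L := by
  have key := sum_measure_eq_zero_of_sum_matrix_det_eq_zero hV hK hL hL hK' hL' hL' hKn hLn hLn μ
    Finset.univ
    ![-1, t / 6 - t ^ 2 / 2 + t ^ 3 / 3, - t / 2 + 2 * t ^ 2 - 3 / 2 * t ^ 3,
      t / 2 - 5 / 2 * t ^ 2 + 3 * t ^ 3, -t / 6 + t ^ 2 - 11 / 6 * t ^ 3 + t ^ 4,
      1 - 6 * t + 11 * t ^ 2 - 6 * t ^ 3]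
    ![1, 3, 2, 1, 0, 1] ![t, 1, 1, 1, 1, 0] ![0, 0, 0, 0, 0, 0]
    (by simp [Fin.forall_fin_succ]) (by simp [Fin.forall_fin_succ, ht])
    (by simp [Fin.forall_fin_succ]) (fun X Y Z => by
      obtain ⟨c₀, c₁, c₂, c₃, h⟩ := Matrix.exists_det_smul_add_smul_eq X Y
      have e3 := h 3 1
      have e2 := h 2 1
      have e1 := h 1 1
      have e0 := h 0 1
      have et := h 1 t
      simp only [one_smul, zero_smul, zero_add] at e0 e1 e2 e3 et
      simp [Fin.sum_univ_succ, e3, e2, e1, e0, et]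
      ring)
  simp [Fin.sum_univ_succ, Set.zero_smul_set, hKn, hLn] at key
  simp only [mixedVolThree, Measure.real]
  linarith

theorem mixedVolThree_mono (hV : finrank ℝ V = 4) (hK : IsCompact K)
    (hL : IsCompact L) (hM : IsCompact M) (hK' : Convex ℝ K) (hL' : Convex ℝ L) (hM' : Convex ℝ M)
    (hKn : K.Nonempty) (hLn : L.Nonempty) (hMn : M.Nonempty) (μ : Measure V) [μ.IsAddHaarMeasure]
    (hLM : L ⊆ M) : mixedVolThree μ K L ≤ mixedVolThree μ K M := by
  have hlim : ∀ m a b c : ℝ, Filter.Tendsto (fun t : ℝ => 4 * m + t * a + t ^ 2 * b + t ^ 3 * c)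
      (nhdsWithin 0 (Set.Ioi 0)) (nhds (4 * m)) := by
    intro m a b c
    have : Continuous fun t : ℝ => 4 * m + t * a + t ^ 2 * b + t ^ 3 * c := by fun_prop
    have h := this.tendsto 0
    simp only [ne_eq, OfNat.ofNat_ne_zero, not_false_eq_true, zero_pow, zero_mul, add_zero] at h
    exact h.mono_left nhdsWithin_le_nhds
  obtain ⟨a, b, c, h1⟩ : ∃ a b c : ℝ, ∀ t : ℝ, 0 ≤ t → μ.real (K + t • L) =
      μ.real K + t * (4 * mixedVolThree μ K L) + t ^ 2 * a + t ^ 3 * b + t ^ 4 * c :=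
    ⟨_, _, _, fun t ht => measure_add_smul_eq hV hK hL hK' hL' hKn hLn μ ht⟩
  obtain ⟨a', b', c', h2⟩ : ∃ a b c : ℝ, ∀ t : ℝ, 0 ≤ t → μ.real (K + t • M) =
      μ.real K + t * (4 * mixedVolThree μ K M) + t ^ 2 * a + t ^ 3 * b + t ^ 4 * c :=
    ⟨_, _, _, fun t ht => measure_add_smul_eq hV hK hM hK' hM' hKn hMn μ ht⟩
  have h4 := le_of_tendsto_of_tendsto (hlim (mixedVolThree μ K L) a b c)
    (hlim (mixedVolThree μ K M) a' b' c')
    (eventually_nhdsWithin_of_forall fun t (ht : 0 < t) => by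
      have h3 : μ.real (K + t • L) ≤ μ.real (K + t • M) :=
        measureReal_mono (Set.add_subset_add_left (Set.smul_set_mono hLM))
          (hK.add (hM.smul t)).measure_lt_top.ne
      rw [h1 t ht.le, h2 t ht.le] at h3
      refine le_of_mul_le_mul_left ?_ ht
      beta_reduce
      linarith)
  linarith

end MixedVolumeExpansion

section SetMixedVolume

variable {V : Type*} [NormedAddCommGroup V] [NormedSpace ℝ V]

theorem Convex.three_smul_eq {K : Set V} (hK : Convex ℝ K) : (3 : ℝ) • K = K + (K + K) := by
  have h2 := hK.add_smul (p := 1) (q := 1) zero_le_one zero_le_one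
  have h3 := hK.add_smul (p := 1) (q := 2) zero_le_one zero_le_two
  norm_num at h2 h3
  rw [h3, h2]

theorem Convex.two_smul_eq {K : Set V} (hK : Convex ℝ K) : (2 : ℝ) • K = K + K := by
  have h2 := hK.add_smul (p := 1) (q := 1) zero_le_one zero_le_one
  norm_num at h2
  exact h2

/-- If the union of two closed convex sets is convex, then Minkowski addition distributes over
their intersection. -/
theorem Convex.inter_add_of_convex_union {K M L : Set V} (hK : IsClosed K) (hM : IsClosed M)
    (hU : Convex ℝ (K ∪ M)) (hL : Convex ℝ L) : K ∩ M + L = (K + L) ∩ (M + L) := by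
  refine subset_antisymm (Set.subset_inter (Set.add_subset_add_right Set.inter_subset_left)
    (Set.add_subset_add_right Set.inter_subset_right)) ?_
  rintro x ⟨⟨k, hk, l, hl, rfl⟩, m, hm, l', hl', h⟩
  obtain ⟨y, ⟨a, b, ha, hb, hab, rfl⟩, hy⟩ := isPreconnected_closed_iff.1
    (convex_segment (𝕜 := ℝ) k m).isPreconnected K M hK hM
    (hU.segment_subset (Or.inl hk) (Or.inr hm)) ⟨k, left_mem_segment ℝ k m, hk⟩
    ⟨m, right_mem_segment ℝ k m, hm⟩
  refine ⟨_, hy, a • l + b • l', hL hl hl' ha hb hab, ?_⟩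
  have h : m + l' = k + l := h
  calc a • k + b • m + (a • l + b • l') = a • (k + l) + b • (m + l') := by
        simp only [smul_add]; abel
    _ = (a + b) • (k + l) := by rw [h, add_smul]
    _ = k + l := by rw [hab, one_smul]

theorem measureReal_union_add_add_inter_add [MeasurableSpace V] [BorelSpace V]
    {K M L : Set V} (hK : IsCompact K) (hM : IsCompact M)
    (hLc : IsCompact L) (hU : Convex ℝ (K ∪ M)) (hL : Convex ℝ L) (μ : Measure V)
    [IsFiniteMeasureOnCompacts μ] :
    μ.real (K ∪ M + L) + μ.real (K ∩ M + L) = μ.real (K + L) + μ.real (M + L) := by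
  rw [Convex.inter_add_of_convex_union hK.isClosed hM.isClosed hU hL, Set.union_add]
  exact measureReal_union_add_inter (hM.add hLc).measurableSet (hK.add hLc).measure_lt_top.ne
    (hM.add hLc).measure_lt_top.ne

variable [MeasurableSpace V] [BorelSpace V] {K L M : Set V}

theorem mixedVolThree_union_add_inter (hK : IsCompact K) (hM : IsCompact M)
    (hLc : IsCompact L) (hU : Convex ℝ (K ∪ M)) (hL : Convex ℝ L) (μ : Measure V)
    [IsFiniteMeasureOnCompacts μ] :
    mixedVolThree μ (K ∪ M) L + mixedVolThree μ (K ∩ M) L =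
      mixedVolThree μ K L + mixedVolThree μ M L := by
  have key : ∀ j : ℝ, j ≠ 0 → μ.real (j • (K ∪ M) + L) + μ.real (j • (K ∩ M) + L) =
      μ.real (j • K + L) + μ.real (j • M + L) := by
    intro j hj
    rw [Set.smul_set_union, Set.smul_set_inter₀ hj]
    refine measureReal_union_add_add_inter_add (hK.smul j) (hM.smul j) hLc ?_ hL μ
    rw [← Set.smul_set_union]
    exact hU.smul j
  have k0 : μ.real (K ∪ M) + μ.real (K ∩ M) = μ.real K + μ.real M :=
    measureReal_union_add_inter hM.measurableSet hK.measure_lt_top.ne hM.measure_lt_top.ne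
  have k1 := key 1 one_ne_zero
  simp only [one_smul] at k1
  have k2 := key 2 two_ne_zero
  have k3 := key 3 three_ne_zero
  simp only [mixedVolThree]
  linarith

theorem mixedVolThree_image_add_left (x : V) (μ : Measure V) [μ.IsAddLeftInvariant] :
    mixedVolThree μ ((fun y => x + y) '' K) L = mixedVolThree μ K L := by
  have h0 : ∀ (z : V) (S : Set V), μ.real ({z} + S) = μ.real S := by
    intro z S
    rw [Set.singleton_add, Set.image_add_left, Measure.real, measure_preimage_add, Measure.real]
  have key : ∀ j : ℝ, μ.real (j • ({x} + K) + L) = μ.real (j • K + L) := by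
    intro j
    rw [smul_add, Set.smul_set_singleton, add_assoc, h0]
  have k1 := key 1
  simp only [one_smul] at k1
  rw [← Set.singleton_add]
  simp only [mixedVolThree, key, k1, h0]

theorem mixedVolThree_image_linearMap [FiniteDimensional ℝ V] (f : V →ₗ[ℝ] V) (μ : Measure V)
    [μ.IsAddHaarMeasure] :
    mixedVolThree μ (f '' K) (f '' L) = |LinearMap.det f| * mixedVolThree μ K L := by
  have h0 : ∀ S : Set V, μ.real (f '' S) = |LinearMap.det f| * μ.real S := by
    intro S
    rw [Measure.real, Measure.addHaar_image_linearMap, ENNReal.toReal_mul,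
      ENNReal.toReal_ofReal (abs_nonneg _), Measure.real]
  have key : ∀ j : ℝ, j • (f '' K) + f '' L = f '' (j • K + L) := by
    intro j
    rw [Set.image_add, image_smul_set]
  have k1 := key 1
  simp only [one_smul] at k1
  simp only [mixedVolThree, key, k1, h0]
  ring

theorem mixedVolThree_smul_right (hV : finrank ℝ V = 4) (hK : IsCompact K) (hL : IsCompact L)
    (hK' : Convex ℝ K) (hL' : Convex ℝ L) (hKn : K.Nonempty) (hLn : L.Nonempty) (μ : Measure V)
    [μ.IsAddHaarMeasure] {r : ℝ} (hr : 0 ≤ r) :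
    mixedVolThree μ K (r • L) = r * mixedVolThree μ K L := by
  have h := mixedVolThree_add_smul hV hK hL hL hK' hL' hL' hKn hLn hLn μ hr le_rfl
  rwa [Set.zero_smul_set hLn, add_zero, zero_mul, add_zero] at h

theorem mixedVolThree_smul_left (hV : finrank ℝ V = 4) (hK : IsCompact K) (hL : IsCompact L)
    (hK' : Convex ℝ K) (hL' : Convex ℝ L) (hKn : K.Nonempty) (hLn : L.Nonempty) (μ : Measure V)
    [μ.IsAddHaarMeasure] {r : ℝ} (hr : 0 < r) :
    mixedVolThree μ (r • K) L = r ^ 3 * mixedVolThree μ K L := by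
  have : FiniteDimensional ℝ V := FiniteDimensional.of_finrank_pos (by omega)
  have h1 := mixedVolThree_image_linearMap (K := K) (L := r⁻¹ • L) (r • LinearMap.id) μ
  have h2 : ∀ S : Set V, (r • LinearMap.id : V →ₗ[ℝ] V) '' S = r • S := fun S => rfl
  rw [h2, h2, smul_inv_smul₀ hr.ne', LinearMap.det_smul, hV, LinearMap.det_id, mul_one,
    abs_of_pos (by positivity)] at h1
  rw [h1, mixedVolThree_smul_right hV hK hL hK' hL' hKn hLn μ (inv_nonneg.2 hr.le)]
  field_simp

theorem measureReal_add_smul_closedBall_le (hV : finrank ℝ V = 4) (hK : IsCompact K)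
    (hK' : Convex ℝ K) (hKn : K.Nonempty) (μ : Measure V) [μ.IsAddHaarMeasure] {R t : ℝ}
    (hR : K ⊆ Metric.closedBall 0 R) (ht : 0 ≤ t) (ht1 : t ≤ 1) :
    μ.real (K + t • Metric.closedBall 0 1) ≤
      μ.real K + t * (20 * μ.real (Metric.closedBall (0 : V) (3 * R + 1))) := by
  have : FiniteDimensional ℝ V := FiniteDimensional.of_finrank_pos (by omega)
  have : ProperSpace V := FiniteDimensional.proper ℝ V
  have hR0 : 0 ≤ R := by
    obtain ⟨x, hx⟩ := hKn
    exact (norm_nonneg x).trans (by simpa using hR hx)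
  set Q := μ.real (Metric.closedBall (0 : V) (3 * R + 1)) with hQ
  have hmono : ∀ S : Set V, S ⊆ Metric.closedBall 0 (3 * R + 1) → μ.real S ≤ Q := fun S hS =>
    measureReal_mono hS (isCompact_closedBall _ _).measure_lt_top.ne
  have hadd : ∀ j : ℝ, 0 ≤ j → j ≤ 3 →
      μ.real (j • K + Metric.closedBall 0 1) ≤ Q := by
    intro j hj hj3
    refine hmono _ ?_
    rintro _ ⟨_, ⟨x, hx, rfl⟩, y, hy, rfl⟩
    have hx' : ‖x‖ ≤ R := by simpa using hR hx
    have hy' : ‖y‖ ≤ 1 := by simpa using hy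
    rw [mem_closedBall_zero_iff]
    calc ‖j • x + y‖ ≤ ‖j • x‖ + ‖y‖ := norm_add_le _ _
      _ ≤ 3 * R + 1 := by
        rw [norm_smul, Real.norm_of_nonneg hj]
        gcongr
  have h3 := hadd 3 (by norm_num) le_rfl
  have h2 := hadd 2 (by norm_num) (by norm_num)
  have h1 := hadd 1 (by norm_num) (by norm_num)
  rw [one_smul] at h1
  have hb : μ.real (Metric.closedBall (0 : V) 1) ≤ Q :=
    hmono _ (Metric.closedBall_subset_closedBall (by linarith))
  have hk : μ.real K ≤ Q := hmono _ (hR.trans (Metric.closedBall_subset_closedBall (by linarith)))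
  rw [measure_add_smul_eq hV hK (isCompact_closedBall 0 1) hK' (convex_closedBall 0 1) hKn
    (Metric.nonempty_closedBall.2 zero_le_one) μ ht, mixedVolThree]
  have n0 : 0 ≤ μ.real K := measureReal_nonneg
  have n1 : 0 ≤ μ.real (K + Metric.closedBall 0 1) := measureReal_nonneg
  have n2 : 0 ≤ μ.real ((2 : ℝ) • K + Metric.closedBall 0 1) := measureReal_nonneg
  have n3 : 0 ≤ μ.real ((3 : ℝ) • K + Metric.closedBall 0 1) := measureReal_nonneg
  have nb : 0 ≤ μ.real (Metric.closedBall (0 : V) 1) := measureReal_nonneg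
  have hpow : ∀ (n : ℕ) (a c : ℝ), a ≤ c → 0 ≤ c → t ^ (n + 1) * a ≤ t * c := by
    intro n a c hac hc
    rw [pow_succ', mul_assoc]
    refine mul_le_mul_of_nonneg_left ?_ ht
    calc t ^ n * a ≤ t ^ n * c := by gcongr
      _ ≤ 1 * c := by gcongr; exact pow_le_one₀ ht ht1
      _ = c := one_mul c
  have hQ0 : 0 ≤ Q := n0.trans hk
  have e1 := hpow 0 _ Q (show 4 * ((μ.real ((3 : ℝ) • K + Metric.closedBall 0 1) -
    3 * μ.real ((2 : ℝ) • K + Metric.closedBall 0 1) + 3 * μ.real (K + Metric.closedBall 0 1) -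
    μ.real (Metric.closedBall (0 : V) 1) - 36 * μ.real K) / 24) ≤ Q by linarith) hQ0
  have e2 := hpow 1 _ (14 * Q) (show (-μ.real ((3 : ℝ) • K + Metric.closedBall 0 1) +
    4 * μ.real ((2 : ℝ) • K + Metric.closedBall 0 1) - 5 * μ.real (K + Metric.closedBall 0 1) +
        2 * μ.real (Metric.closedBall (0 : V) 1) + 22 * μ.real K) / 2 ≤ 14 * Q by linarith)
        (by positivity)
  have e3 := hpow 2 _ (4 * Q) (show (2 * μ.real ((3 : ℝ) • K + Metric.closedBall 0 1) -
    9 * μ.real ((2 : ℝ) • K + Metric.closedBall 0 1) + 18 * μ.real (K + Metric.closedBall 0 1) -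
    11 * μ.real (Metric.closedBall (0 : V) 1) - 36 * μ.real K) / 6 ≤ 4 * Q by linarith)
    (by positivity)
  have e4 := hpow 3 _ Q hb hQ0
  norm_num at e1 e2 e3 e4
  linarith

theorem abs_measureReal_sub_le (hV : finrank ℝ V = 4) (hK : IsCompact K) (hM : IsCompact M)
    (hK' : Convex ℝ K) (hM' : Convex ℝ M) (hKn : K.Nonempty) (hMn : M.Nonempty) (μ : Measure V)
    [μ.IsAddHaarMeasure] {R t : ℝ} (hKR : K ⊆ Metric.closedBall 0 R)
    (hMR : M ⊆ Metric.closedBall 0 R) (ht : 0 ≤ t) (ht1 : t ≤ 1)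
    (hKM : K ⊆ M + t • Metric.closedBall 0 1) (hMK : M ⊆ K + t • Metric.closedBall 0 1) :
    |μ.real K - μ.real M| ≤ t * (20 * μ.real (Metric.closedBall (0 : V) (3 * R + 1))) := by
  have : FiniteDimensional ℝ V := FiniteDimensional.of_finrank_pos (by omega)
  have : ProperSpace V := FiniteDimensional.proper ℝ V
  have hb : IsCompact (t • Metric.closedBall (0 : V) 1) := (isCompact_closedBall 0 1).smul t
  have h1 := (measureReal_mono hKM (hM.add hb).measure_lt_top.ne).trans
    (measureReal_add_smul_closedBall_le hV hM hM' hMn μ hMR ht ht1)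
  have h2 := (measureReal_mono hMK (hK.add hb).measure_lt_top.ne).trans
    (measureReal_add_smul_closedBall_le hV hK hK' hKn μ hKR ht ht1)
  rw [abs_le]
  constructor <;> linarith

theorem abs_mixedVolThree_sub_le (hV : finrank ℝ V = 4) (hK : IsCompact K) (hM : IsCompact M)
    (hL : IsCompact L) (hK' : Convex ℝ K) (hM' : Convex ℝ M) (hL' : Convex ℝ L)
    (hKn : K.Nonempty) (hMn : M.Nonempty) (hLn : L.Nonempty) (μ : Measure V)
    [μ.IsAddHaarMeasure] {R t : ℝ} (hKR : K ⊆ Metric.closedBall 0 R)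
    (hMR : M ⊆ Metric.closedBall 0 R) (hLR : L ⊆ Metric.closedBall 0 R) (ht : 0 ≤ t)
    (ht1 : 3 * t ≤ 1)
    (hKM : K ⊆ M + t • Metric.closedBall 0 1) (hMK : M ⊆ K + t • Metric.closedBall 0 1) :
    |mixedVolThree μ K L - mixedVolThree μ M L| ≤
      t * (40 * μ.real (Metric.closedBall (0 : V) (3 * (4 * R) + 1))) := by
  have hR0 : 0 ≤ R := by
    obtain ⟨x, hx⟩ := hKn
    exact (norm_nonneg x).trans (by simpa using hKR hx)
  have hball : ∀ (S : Set V), S ⊆ Metric.closedBall 0 R → ∀ j : ℝ, 0 ≤ j → j ≤ 3 →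
      j • S + L ⊆ Metric.closedBall 0 (4 * R) := by
    rintro S hS j hj hj3 _ ⟨_, ⟨x, hx, rfl⟩, y, hy, rfl⟩
    have hx' : ‖x‖ ≤ R := by simpa using hS hx
    have hy' : ‖y‖ ≤ R := by simpa using hLR hy
    rw [mem_closedBall_zero_iff]
    calc ‖j • x + y‖ ≤ ‖j • x‖ + ‖y‖ := norm_add_le _ _
      _ ≤ 3 * R + R := by
        rw [norm_smul, Real.norm_of_nonneg hj]
        gcongr
      _ = 4 * R := by ring
  have hincl : ∀ (S T : Set V), S ⊆ T + t • Metric.closedBall 0 1 → ∀ j : ℝ,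
      j • S + L ⊆ j • T + L + (j * t) • Metric.closedBall 0 1 := by
    intro S T h j
    calc j • S + L ⊆ j • (T + t • Metric.closedBall 0 1) + L :=
          Set.add_subset_add_right (Set.smul_set_mono h)
      _ = j • T + L + (j * t) • Metric.closedBall 0 1 := by
          rw [smul_add, smul_smul, add_right_comm]
  have key : ∀ j : ℝ, 0 ≤ j → j ≤ 3 → |μ.real (j • K + L) - μ.real (j • M + L)| ≤
      j * t * (20 * μ.real (Metric.closedBall (0 : V) (3 * (4 * R) + 1))) := by
    intro j hj hj3
    exact abs_measureReal_sub_le hV ((hK.smul j).add hL) ((hM.smul j).add hL)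
      ((hK'.smul j).add hL') ((hM'.smul j).add hL') (hKn.smul_set.add hLn) (hMn.smul_set.add hLn) μ
      (hball K hKR j hj hj3) (hball M hMR j hj hj3) (by positivity) (by nlinarith)
      (hincl K M hKM j) (hincl M K hMK j)
  have k3 := key 3 (by norm_num) le_rfl
  have k2 := key 2 (by norm_num) (by norm_num)
  have k1 := key 1 (by norm_num) (by norm_num)
  rw [one_smul, one_smul] at k1
  have hsub : Metric.closedBall (0 : V) R ⊆ Metric.closedBall 0 (4 * R) :=
    Metric.closedBall_subset_closedBall (by linarith)
  have k0 := abs_measureReal_sub_le hV hK hM hK' hM' hKn hMn μ (hKR.trans hsub) (hMR.trans hsub)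
    ht (by linarith) hKM hMK
  rw [abs_le] at k0 k1 k2 k3
  simp only [mixedVolThree]
  rw [abs_le]
  constructor <;> linarith [k0.1, k0.2, k1.1, k1.2, k2.1, k2.2, k3.1, k3.2]

theorem mixedVol_eq_mixedVolThree (hV : finrank ℝ V = 4) (μ : Measure V) [μ.IsAddHaarMeasure]
    (K L : ConvexBody V) :
    mixedVol μ ![K, K, K, L] = mixedVolThree μ (K : Set V) (L : Set V) := by
  have : FiniteDimensional ℝ V := FiniteDimensional.of_finrank_pos (by omega)
  have : Nontrivial V := Module.nontrivial_of_finrank_pos (R := ℝ) (by omega)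
  have h0 : ∀ j : ℝ, 0 ≤ j → μ.real (j • (K : Set V)) = j ^ 4 * μ.real (K : Set V) := by
    intro j hj
    rw [Measure.real, Measure.addHaar_smul, hV, ENNReal.toReal_mul,
      ENNReal.toReal_ofReal (abs_nonneg _), abs_of_nonneg (by positivity), Measure.real]
  have k3 := h0 3 (by norm_num)
  have k2 := h0 2 (by norm_num)
  rw [K.convex.three_smul_eq] at k3
  rw [K.convex.two_smul_eq] at k2
  rw [mixedVol, mixedVolThree, K.convex.three_smul_eq, K.convex.two_smul_eq]
  have hu : (Finset.univ : Finset (Finset (Fin 4))) = {∅, {0}, {1}, {2}, {3}, {0, 1}, {0, 2},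
    {1, 2}, {0, 3}, {1, 3}, {2, 3}, {0, 1, 2}, {0, 1, 3}, {0, 2, 3}, {1, 2, 3}, {0, 1, 2, 3}} := by
    decide
  rw [hu]
  repeat rw [Finset.sum_insert (by decide)]
  have hz : μ (0 : Set V) = 0 := measure_singleton 0
  simp [hz, Nat.factorial]
  simp only [Measure.real, ← add_assoc] at *
  linarith

end SetMixedVolume

section SupportFunction

variable {V V' : Type*} [NormedAddCommGroup V] [NormedSpace ℝ V]
  [NormedAddCommGroup V'] [NormedSpace ℝ V'] {K L : ConvexBody V} {p : V → ℝ}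

theorem le_hSupp (hp : Continuous p) {x : V} (hx : x ∈ K) : p x ≤ hSupp K p :=
  le_csSup (K.isCompact.image hp).bddAbove ⟨x, hx, rfl⟩

theorem exists_hSupp_eq (K : ConvexBody V) (hp : Continuous p) : ∃ x ∈ K, hSupp K p = p x :=
  K.isCompact.exists_sSup_image_eq K.nonempty hp.continuousOn

theorem hSupp_add (p : V →L[ℝ] ℝ) : hSupp (K + L) p = hSupp K p + hSupp L p := by
  refine le_antisymm ?_ ?_
  · obtain ⟨_, ⟨y, hy, z, hz, rfl⟩, h⟩ := exists_hSupp_eq (K + L) p.continuous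
    rw [h, map_add]
    exact add_le_add (le_hSupp p.continuous hy) (le_hSupp p.continuous hz)
  · obtain ⟨y, hy, hK⟩ := exists_hSupp_eq K p.continuous
    obtain ⟨z, hz, hL⟩ := exists_hSupp_eq L p.continuous
    rw [hK, hL, ← map_add]
    exact le_hSupp p.continuous (K := K + L) ⟨y, hy, z, hz, rfl⟩

theorem hSupp_smul (p : V →L[ℝ] ℝ) {r : ℝ} (hr : 0 ≤ r) :
    hSupp (r • K) p = r * hSupp K p := by
  refine le_antisymm ?_ ?_
  · obtain ⟨_, ⟨y, hy, rfl⟩, h⟩ := exists_hSupp_eq (r • K) p.continuous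
    rw [h, map_smul, smul_eq_mul]
    exact mul_le_mul_of_nonneg_left (le_hSupp p.continuous hy) hr
  · obtain ⟨y, hy, hK⟩ := exists_hSupp_eq K p.continuous
    rw [hK, ← smul_eq_mul, ← map_smul]
    exact le_hSupp p.continuous (K := r • K) ⟨y, hy, rfl⟩

theorem hSupp_mapCLM (f : V →L[ℝ] V') (p : V' → ℝ) :
    hSupp (K.mapCLM f) p = hSupp K fun x => p (f x) := by
  rw [hSupp, hSupp, ← Set.image_image p f]
  rfl

/-- A sublinear functional has a linear minorant touching it at a given vector. -/
theorem exists_linearMap_le_sublinear {E : Type*} [AddCommGroup E] [Module ℝ E] {p : E → ℝ}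
    (hsmul : ∀ c : ℝ, 0 ≤ c → ∀ x, p (c • x) = c * p x) (hadd : ∀ x y, p (x + y) ≤ p x + p y)
    (w : E) : ∃ g : E →ₗ[ℝ] ℝ, g w = p w ∧ ∀ x, g x ≤ p x := by
  have h0 : p 0 = 0 := by simpa using hsmul 0 le_rfl 0
  have hline : ∀ c : ℝ, c * p w ≤ p (c • w) := by
    intro c
    rcases le_total 0 c with hc | hc
    · exact (hsmul c hc w).ge
    · have h1 := hadd (c • w) ((-c) • w)
      rw [← add_smul, add_neg_cancel, zero_smul, h0, hsmul (-c) (neg_nonneg.2 hc)] at h1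
      linarith
  have H : ∀ c : ℝ, c • w = 0 → RingHom.id ℝ c • p w = 0 := by
    intro c hc
    rcases smul_eq_zero.1 hc with rfl | rfl
    · simp
    · simp [h0]
  obtain ⟨g, hg, hgp⟩ := exists_extension_of_le_sublinear (LinearPMap.mkSpanSingleton' w (p w) H) p
    (fun c hc => hsmul c hc.le) hadd (by
      rintro ⟨x, hx⟩
      obtain ⟨c, rfl⟩ := Submodule.mem_span_singleton.1 hx
      rw [LinearPMap.mkSpanSingleton'_apply]
      exact hline c)
  refine ⟨g, ?_, hgp⟩
  have hw : (1 : ℝ) • w ∈ (LinearPMap.mkSpanSingleton' w (p w) H).domain :=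
    Submodule.mem_span_singleton.2 ⟨1, rfl⟩
  have := hg ⟨_, hw⟩
  rw [LinearPMap.mkSpanSingleton'_apply] at this
  simpa using this

end SupportFunction

section ComplexDual

variable {W : Type*} [NormedAddCommGroup W] [NormedSpace ℂ W]

/-- The real part of the evaluation at `w`, as a real functional on the complex dual. -/
def reEval (w : W) : (W →L[ℂ] ℂ) →L[ℝ] ℝ :=
  Complex.reCLM.comp ((ContinuousLinearMap.apply ℂ ℂ w).restrictScalars ℝ)

theorem reEval_apply (w : W) (ξ : W →L[ℂ] ℂ) : reEval w ξ = (ξ w).re := rfl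

variable [FiniteDimensional ℂ W]

theorem exists_eq_reEval (f : (W →L[ℂ] ℂ) →L[ℝ] ℝ) : ∃ w : W, f = reEval w := by
  let F : Module.Dual ℂ (W →L[ℂ] ℂ) := Module.Dual.extendRCLike (𝕜 := ℂ) (f : (W →L[ℂ] ℂ) →ₗ[ℝ] ℝ)
  let G : Module.Dual ℂ (Module.Dual ℂ W) :=
    F ∘ₗ (LinearMap.toContinuousLinearMap : (W →ₗ[ℂ] ℂ) ≃ₗ[ℂ] W →L[ℂ] ℂ).toLinearMap
  refine ⟨(Module.evalEquiv ℂ W).symm G, ContinuousLinearMap.ext fun ξ => ?_⟩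
  have h1 := Module.apply_evalEquiv_symm_apply ℂ W (ξ : W →ₗ[ℂ] ℂ) G
  have h2 : RCLike.re (F ξ) = f ξ :=
    Module.Dual.re_extendRCLike_apply (𝕜 := ℂ) (f : (W →L[ℂ] ℂ) →ₗ[ℝ] ℝ) ξ
  have h3 : G (ξ : W →ₗ[ℂ] ℂ) = F ξ := rfl
  rw [reEval_apply, ← h2, ← h3, ← h1]
  rfl

theorem exists_convexBody_hSupp_eq {p : W → ℝ} {C : ℝ} (hC : 0 ≤ C)
    (hsmul : ∀ c : ℝ, 0 ≤ c → ∀ x, p (c • x) = c * p x) (hadd : ∀ x y, p (x + y) ≤ p x + p y)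
    (hbound : ∀ w, p w ≤ C * ‖w‖) :
    ∃ L : ConvexBody (W →L[ℂ] ℂ), ∀ w : W, hSupp L (fun ξ => (ξ w).re) = p w := by
  have : ProperSpace (W →L[ℂ] ℂ) := FiniteDimensional.proper ℂ _
  have hext : ∀ w, ∃ ξ : W →L[ℂ] ℂ, (ξ w).re = p w ∧ ∀ x, (ξ x).re ≤ p x := by
    intro w
    obtain ⟨g, hg, hgp⟩ := exists_linearMap_le_sublinear hsmul hadd w
    refine ⟨LinearMap.toContinuousLinearMap (Module.Dual.extendRCLike (𝕜 := ℂ) g), ?_, fun x => ?_⟩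
    · rw [← hg]
      exact Module.Dual.re_extendRCLike_apply (𝕜 := ℂ) g w
    · exact (Module.Dual.re_extendRCLike_apply (𝕜 := ℂ) g x).trans_le (hgp x)
  have heq : {ξ : W →L[ℂ] ℂ | ∀ w, (ξ w).re ≤ p w} = ⋂ w, {ξ | reEval w ξ ≤ p w} := by
    ext ξ
    simp [reEval_apply]
  have hclosed : IsClosed {ξ : W →L[ℂ] ℂ | ∀ w, (ξ w).re ≤ p w} := by
    rw [heq]
    exact isClosed_iInter fun w => isClosed_le (reEval w).continuous continuous_const
  have hconvex : Convex ℝ {ξ : W →L[ℂ] ℂ | ∀ w, (ξ w).re ≤ p w} := by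
    rw [heq]
    exact convex_iInter fun w => convex_halfSpace_le (reEval w).isLinear _
  have hsub : {ξ : W →L[ℂ] ℂ | ∀ w, (ξ w).re ≤ p w} ⊆ Metric.closedBall 0 C := by
    intro ξ hξ
    rw [mem_closedBall_zero_iff]
    refine ξ.opNorm_le_bound hC fun w => ?_
    obtain ⟨c, hc, h⟩ := RCLike.exists_norm_eq_mul_self (ξ w)
    have h1 : ξ (c • w) = (‖ξ w‖ : ℂ) := by
      rw [map_smul, smul_eq_mul]
      exact h.symm
    calc ‖ξ w‖ = (ξ (c • w)).re := by rw [h1, Complex.ofReal_re]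
      _ ≤ C * ‖c • w‖ := (hξ _).trans (hbound _)
      _ = C * ‖w‖ := by rw [norm_smul, hc, one_mul]
  have hcompact := (isCompact_closedBall (0 : W →L[ℂ] ℂ) C).of_isClosed_subset hclosed hsub
  obtain ⟨ξ₀, -, hξ₀⟩ := hext 0
  refine ⟨⟨_, hconvex, hcompact, ξ₀, hξ₀⟩, fun w => le_antisymm ?_ ?_⟩
  · obtain ⟨ξ, hξ, h⟩ := exists_hSupp_eq (⟨_, hconvex, hcompact, ξ₀, hξ₀⟩ : ConvexBody (W →L[ℂ] ℂ))
      (reEval w).continuous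
    exact h.trans_le (hξ w)
  · obtain ⟨ξ, hw, hξ⟩ := hext w
    rw [← hw]
    exact le_hSupp (K := (⟨_, hconvex, hcompact, ξ₀, hξ₀⟩ : ConvexBody (W →L[ℂ] ℂ)))
      (reEval w).continuous hξ

theorem exists_dist_le_of_hSupp_le {A B : ConvexBody (W →L[ℂ] ℂ)} {ε : ℝ} (hε : 0 ≤ ε)
    (h : ∀ w : W, hSupp A (reEval w) ≤ hSupp B (reEval w) + ε * ‖w‖) {a : W →L[ℂ] ℂ}
    (ha : a ∈ A) : ∃ b ∈ B, dist a b ≤ ε := by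
  have : ProperSpace (W →L[ℂ] ℂ) := FiniteDimensional.proper ℂ _
  suffices hmem : a ∈ (B : Set (W →L[ℂ] ℂ)) + Metric.closedBall 0 ε by
    obtain ⟨b, hb, c, hc, rfl⟩ := hmem
    exact ⟨b, hb, by simpa [dist_eq_norm] using hc⟩
  by_contra hmem
  obtain ⟨f, u, hlt, hu⟩ := geometric_hahn_banach_closed_point
    (B.convex.add (convex_closedBall 0 ε)) (B.isCompact.add (isCompact_closedBall 0 ε)).isClosed hmem
  obtain ⟨w, rfl⟩ := exists_eq_reEval f
  obtain ⟨b, hb, hbw⟩ := exists_hSupp_eq B (reEval w).continuous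
  obtain ⟨η, hη, hηw⟩ := exists_dual_vector'' ℂ w
  have h1 := hlt (b + (ε : ℂ) • η) ⟨b, hb, _, by
    rw [mem_closedBall_zero_iff, norm_smul, Complex.norm_real, Real.norm_of_nonneg hε]
    exact mul_le_of_le_one_right hε hη, rfl⟩
  have h2 : reEval w ((ε : ℂ) • η) = ε * ‖w‖ := by
    rw [reEval_apply, smul_apply, hηw]
    simp
  rw [map_add, h2, ← hbw] at h1
  have h3 := le_hSupp (reEval w).continuous ha
  linarith [h w]

theorem dist_le_of_abs_hSupp_sub_le {A B : ConvexBody (W →L[ℂ] ℂ)} {ε : ℝ} (hε : 0 ≤ ε)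
    (h : ∀ w : W, |hSupp A (reEval w) - hSupp B (reEval w)| ≤ ε * ‖w‖) : dist A B ≤ ε := by
  rw [← ConvexBody.hausdorffDist_coe]
  refine Metric.hausdorffDist_le_of_mem_dist hε
    (fun a ha => exists_dist_le_of_hSupp_le hε (fun w => ?_) ha)
    (fun b hb => exists_dist_le_of_hSupp_le hε (fun w => ?_) hb)
  · linarith [(abs_le.1 (h w)).2]
  · linarith [(abs_le.1 (h w)).1]

theorem ConvexBody.ext_of_hSupp_eq {A B : ConvexBody (W →L[ℂ] ℂ)}
    (h : ∀ w : W, hSupp A (reEval w) = hSupp B (reEval w)) : A = B :=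
  dist_le_zero.1 (dist_le_of_abs_hSupp_sub_le le_rfl fun w => by simp [h w])

end ComplexDual

section ProjectionBody

variable {W : Type*} [NormedAddCommGroup W] [NormedSpace ℂ W]

theorem coe_dotBody (N : ConvexBody ℂ) (w : W) :
    (dotBody N w : Set W) = (fun c : ℂ => c • w) '' (N : Set ℂ) := rfl

theorem smul_dotBody (N : ConvexBody ℂ) (r : ℝ) (w : W) :
    (dotBody N (r • w) : Set W) = r • (dotBody N w : Set W) := by
  rw [coe_dotBody, coe_dotBody, ← Set.image_smul, Set.image_image]
  simp only [smul_comm r]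

theorem dotBody_add_subset (N : ConvexBody ℂ) (v w : W) :
    (dotBody N (v + w) : Set W) ⊆ (dotBody N v : Set W) + (dotBody N w : Set W) := by
  rintro _ ⟨c, hc, rfl⟩
  exact ⟨c • v, ⟨c, hc, rfl⟩, c • w, ⟨c, hc, rfl⟩, (smul_add c v w).symm⟩

theorem dotBody_subset_closedBall {N : ConvexBody ℂ} {R : ℝ}
    (hN : (N : Set ℂ) ⊆ Metric.closedBall 0 R) (w : W) :
    (dotBody N w : Set W) ⊆ Metric.closedBall 0 (R * ‖w‖) := by
  rintro _ ⟨c, hc, rfl⟩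
  rw [mem_closedBall_zero_iff]
  refine (norm_smul_le c w).trans ?_
  gcongr
  simpa using hN hc

theorem image_dotBody (N : ConvexBody ℂ) (f : W →ₗ[ℂ] W) (w : W) :
    f '' (dotBody N w : Set W) = (dotBody N (f w) : Set W) := by
  rw [coe_dotBody, coe_dotBody, Set.image_image]
  simp only [map_smul]

theorem ConvexBody.exists_subset_closedBall {V : Type*} [NormedAddCommGroup V] [NormedSpace ℝ V]
    (K : ConvexBody V) : ∃ R : ℝ, 0 ≤ R ∧ (K : Set V) ⊆ Metric.closedBall 0 R := by
  obtain ⟨R, hR⟩ := K.isCompact.isBounded.subset_closedBall 0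
  exact ⟨max R 0, le_max_right _ _, hR.trans (Metric.closedBall_subset_closedBall (le_max_left _ _))⟩

theorem ConvexBody.subset_add_smul_closedBall {V : Type*} [NormedAddCommGroup V] [NormedSpace ℝ V]
    {K L : ConvexBody V} {t : ℝ} (h : dist K L < t) :
    (K : Set V) ⊆ (L : Set V) + t • Metric.closedBall 0 1 := by
  intro x hx
  obtain ⟨y, hy, hxy⟩ := Metric.exists_dist_lt_of_hausdorffDist_lt hx
    ((ConvexBody.hausdorffDist_coe K L).trans_lt h) ConvexBody.hausdorffEDist_ne_top
  rw [smul_unitClosedBall_of_nonneg (dist_nonneg.trans h.le)]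
  exact ⟨y, hy, x - y, by simpa [dist_eq_norm] using hxy.le, add_sub_cancel y x⟩

variable [FiniteDimensional ℂ W] [MeasurableSpace W] [BorelSpace W] (μ : Measure W) [μ.IsAddHaarMeasure]

theorem exists_hSupp_eq_mixedVolThree (hW : finrank ℝ W = 4) (N : ConvexBody ℂ)
    (K : ConvexBody W) : ∃ L : ConvexBody (W →L[ℂ] ℂ), ∀ w : W,
      hSupp L (fun ξ => (ξ w).re) = mixedVolThree μ (K : Set W) (dotBody N w : Set W) := by
  have : FiniteDimensional ℝ W := FiniteDimensional.of_finrank_pos (by omega)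
  have : ProperSpace W := FiniteDimensional.proper ℝ W
  obtain ⟨R, hR, hN⟩ := N.exists_subset_closedBall
  refine exists_convexBody_hSupp_eq
    (C := R * |mixedVolThree μ (K : Set W) (Metric.closedBall 0 1)|) (by positivity) ?_ ?_ ?_
  · intro c hc x
    rw [smul_dotBody, mixedVolThree_smul_right hW K.isCompact (dotBody N x).isCompact K.convex
      (dotBody N x).convex K.nonempty (dotBody N x).nonempty μ hc]
  · intro x y
    have h := mixedVolThree_add_smul hW K.isCompact (dotBody N x).isCompact (dotBody N y).isCompact
      K.convex (dotBody N x).convex (dotBody N y).convex K.nonempty (dotBody N x).nonempty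
      (dotBody N y).nonempty μ zero_le_one zero_le_one
    simp only [one_smul, one_mul] at h
    rw [← h]
    exact mixedVolThree_mono hW K.isCompact (dotBody N (x + y)).isCompact
      ((dotBody N x).isCompact.add (dotBody N y).isCompact) K.convex (dotBody N (x + y)).convex
      ((dotBody N x).convex.add (dotBody N y).convex) K.nonempty (dotBody N (x + y)).nonempty
      ((dotBody N x).nonempty.add (dotBody N y).nonempty) μ (dotBody_add_subset N x y)
  · intro w
    have hsub : (dotBody N w : Set W) ⊆ (R * ‖w‖) • Metric.closedBall (0 : W) 1 := by
      rw [smul_unitClosedBall_of_nonneg (by positivity)]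
      exact dotBody_subset_closedBall hN w
    have hb : (Metric.closedBall (0 : W) 1).Nonempty := Metric.nonempty_closedBall.2 zero_le_one
    refine (mixedVolThree_mono hW K.isCompact (dotBody N w).isCompact
      ((isCompact_closedBall 0 1).smul _) K.convex (dotBody N w).convex
      ((convex_closedBall 0 1).smul _) K.nonempty (dotBody N w).nonempty hb.smul_set μ
      hsub).trans ?_
    rw [mixedVolThree_smul_right hW K.isCompact (isCompact_closedBall 0 1) K.convex
      (convex_closedBall 0 1) K.nonempty hb μ (by positivity), mul_right_comm]
    gcongr
    exact le_abs_self _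

variable {μ} {N : ConvexBody ℂ} {D : ConvexBody W → ConvexBody (W →L[ℂ] ℂ)}

theorem continuous_of_hSupp_eq_mixedVolThree (hW : finrank ℝ W = 4)
    (hD : ∀ (K : ConvexBody W) (w : W),
      hSupp (D K) (reEval w) = mixedVolThree μ (K : Set W) (dotBody N w : Set W)) :
    Continuous D := by
  rw [Metric.continuous_iff]
  intro K ε hε
  obtain ⟨R₁, hR₁, hN⟩ := N.exists_subset_closedBall
  obtain ⟨R₂, hR₂, hK⟩ := K.exists_subset_closedBall
  set R := R₁ + R₂ + 1 with hR
  set M := 40 * μ.real (Metric.closedBall (0 : W) (3 * (4 * R) + 1)) with hM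
  have hM0 : 0 ≤ M := by positivity
  set t := min (1 / 3) (ε / (M + 1)) with ht
  have ht0 : 0 < t := by positivity
  have ht3 : 3 * t ≤ 1 := by linarith [min_le_left (1 / 3) (ε / (M + 1))]
  have htM : t * M < ε := by
    calc t * M < t * (M + 1) := by gcongr; linarith
      _ ≤ ε / (M + 1) * (M + 1) := by gcongr; exact min_le_right _ _
      _ = ε := by field_simp
  refine ⟨t, ht0, fun L hL => (dist_le_of_abs_hSupp_sub_le (by positivity) fun w => ?_).trans_lt htM⟩
  have hLK := ConvexBody.subset_add_smul_closedBall hL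
  have hKL := ConvexBody.subset_add_smul_closedBall (dist_comm L K ▸ hL)
  have hKR : (K : Set W) ⊆ Metric.closedBall 0 R :=
    hK.trans (Metric.closedBall_subset_closedBall (by linarith))
  have hLR : (L : Set W) ⊆ Metric.closedBall 0 R := by
    rw [smul_unitClosedBall_of_nonneg ht0.le] at hLK
    refine hLK.trans ?_
    rintro _ ⟨x, hx, y, hy, rfl⟩
    have hx' := hK hx
    rw [mem_closedBall_zero_iff] at *
    exact (norm_add_le x y).trans (by linarith)
  have key : ∀ u : W, ‖u‖ ≤ 1 → |mixedVolThree μ (L : Set W) (dotBody N u : Set W) -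
      mixedVolThree μ (K : Set W) (dotBody N u : Set W)| ≤ t * M := by
    intro u hu
    have hNR : (dotBody N u : Set W) ⊆ Metric.closedBall 0 R :=
      (dotBody_subset_closedBall hN u).trans (Metric.closedBall_subset_closedBall (by nlinarith))
    exact abs_mixedVolThree_sub_le hW L.isCompact K.isCompact (dotBody N u).isCompact L.convex
      K.convex (dotBody N u).convex L.nonempty K.nonempty (dotBody N u).nonempty μ hLR hKR hNR
      ht0.le ht3 hLK hKL
  have hw : ∀ J : ConvexBody W, mixedVolThree μ (J : Set W) (dotBody N w : Set W) =
      ‖w‖ * mixedVolThree μ (J : Set W) (dotBody N (‖w‖⁻¹ • w) : Set W) := by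
    intro J
    rw [← mixedVolThree_smul_right hW J.isCompact (dotBody N _).isCompact J.convex
      (dotBody N _).convex J.nonempty (dotBody N _).nonempty μ (norm_nonneg w), ← smul_dotBody]
    rcases eq_or_ne w 0 with rfl | hw
    · simp
    · rw [smul_inv_smul₀ (norm_ne_zero_iff.2 hw)]
  rw [hD, hD, hw L, hw K, ← mul_sub, abs_mul, abs_norm, mul_comm]
  refine mul_le_mul_of_nonneg_right (key _ ?_) (norm_nonneg w)
  rw [norm_smul, norm_inv, norm_norm]
  exact inv_mul_le_one

theorem isSLContravariant_of_hSupp_eq_mixedVolThree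
    (hD : ∀ (K : ConvexBody W) (w : W),
      hSupp (D K) (reEval w) = mixedVolThree μ (K : Set W) (dotBody N w : Set W)) :
    IsSLContravariant D := by
  have : FiniteDimensional ℝ W := FiniteDimensional.complexToReal W
  intro g hg K
  refine ConvexBody.ext_of_hSupp_eq fun w => ?_
  have h1 : hSupp ((D K).mapCLM (precompDual (g.symm : W →L[ℂ] W))) (reEval w) =
      hSupp (D K) (reEval (g.symm w)) := hSupp_mapCLM _ _
  have h2 : ((K.mapCLM (cReal (g : W →ₗ[ℂ] W)) : ConvexBody W) : Set W) =
      (((g : W →L[ℂ] W) : W →ₗ[ℂ] W).restrictScalars ℝ) '' (K : Set W) := rfl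
  have h3 : (dotBody N w : Set W) =
      (((g : W →L[ℂ] W) : W →ₗ[ℂ] W).restrictScalars ℝ) '' (dotBody N (g.symm w) : Set W) := by
    have := image_dotBody N ((g : W →L[ℂ] W) : W →ₗ[ℂ] W) (g.symm w)
    rw [show ((g : W →L[ℂ] W) : W →ₗ[ℂ] W) (g.symm w) = w from g.apply_symm_apply w] at this
    exact this.symm
  rw [h1, hD, hD, h2, h3, mixedVolThree_image_linearMap, LinearMap.det_restrictScalars, hg, map_one,
    abs_one, one_mul]

end ProjectionBody

/-- Let `W` be a 2-dimensional complex vector space (with a fixed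
Lebesgue measure `μ` for mixed volumes) and let `N ∈ 𝒦(ℂ)`. Then for every `K ∈ 𝒦(W)`
the function `w ↦ V(K, K, K, N·w)` is the support function of a convex body
`Π_N K ∈ 𝒦(W*)`, and the map `Π_N : 𝒦(W) → 𝒦(W*)` so defined is a continuous,
translation invariant, `SL(W,ℂ)`-contravariant Minkowski valuation which is homogeneous
of degree `3`, i.e. `Π_N (λ K) = λ³ Π_N K` for `λ > 0`. -/
theorem PiN_is_contravariant_valuation
    {W : Type*} [NormedAddCommGroup W] [NormedSpace ℂ W] [FiniteDimensional ℂ W]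
    (hW : Module.finrank ℂ W = 2)
    [MeasurableSpace W] [BorelSpace W] (μ : Measure W) [μ.IsAddHaarMeasure]
    (N : ConvexBody ℂ) :
    (∀ K : ConvexBody W, ∃ L : ConvexBody (W →L[ℂ] ℂ), ∀ w : W,
      hSupp L (fun ξ => (ξ w).re) = mixedVol μ ![K, K, K, dotBody N w]) ∧
    (∀ D : ConvexBody W → ConvexBody (W →L[ℂ] ℂ),
      (∀ (K : ConvexBody W) (w : W),
        hSupp (D K) (fun ξ => (ξ w).re) = mixedVol μ ![K, K, K, dotBody N w]) →
      Continuous D ∧ IsTranslationInvariant D ∧ IsMinkowskiValuation D ∧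
        IsSLContravariant D ∧
        ∀ (K : ConvexBody W) (l : ℝ), 0 < l → D (l • K) = l ^ 3 • D K) := by
  have hV : finrank ℝ W = 4 := by rw [finrank_real_of_complex, hW]
  simp only [mixedVol_eq_mixedVolThree hV]
  refine ⟨exists_hSupp_eq_mixedVolThree μ hV N, fun D hD => ?_⟩
  replace hD : ∀ (K : ConvexBody W) (w : W), hSupp (D K) (reEval w) =
    mixedVolThree μ (K : Set W) (dotBody N w : Set W) := hD
  refine ⟨continuous_of_hSupp_eq_mixedVolThree hV hD, fun K x => ?_, fun K L hU hI => ?_,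
    isSLContravariant_of_hSupp_eq_mixedVolThree hD, fun K l hl => ?_⟩ <;>
  refine ConvexBody.ext_of_hSupp_eq fun w => ?_
  · rw [hD, hD]
    exact mixedVolThree_image_add_left x μ
  · rw [hSupp_add, hSupp_add, hD, hD, hD, hD]
    exact mixedVolThree_union_add_inter K.isCompact L.isCompact (dotBody N w).isCompact hU
      (dotBody N w).convex μ
  · rw [hSupp_smul _ (by positivity), hD, hD, ConvexBody.coe_smul,
      mixedVolThree_smul_left hV K.isCompact (dotBody N w).isCompact K.convex (dotBody N w).convex
      K.nonempty (dotBody N w).nonempty μ hl]
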